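/- arXiv:2410.12447 — 13 statements merged into one kernel-verified Lean document; each statement's English description precedes it below -/
import Mathlib

section
/- Let K be a field of characteristic 0 and let P, Q ∈ K[X] be nonconstant ϱ-polynomials that are associate, i.e. Q = α ∘ P ∘ β for some polynomials α, β ∈ K[X] of degree 1. Then deg P = deg Q and P and Q have the same support: for every natural number i, the coefficient of X^i in P is zero if and only if the coefficient of X^i in Q is zero (in particular P and Q have the same bi-degree). -/
open Polynomial

namespace Polynomial

theorem coeff_taylor_natDegree_sub_one {R : Type*} [CommSemiring R] (p : R[X]) (r : R)
    (hp : 1 ≤ p.natDegree) :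
    (taylor r p).coeff (p.natDegree - 1) =
      p.coeff (p.natDegree - 1) + p.natDegree * p.leadingCoeff * r := by
  obtain ⟨n, hn⟩ := Nat.exists_eq_add_of_le' hp
  have hdeg : (hasseDeriv n p).natDegree < 2 := by
    have := natDegree_hasseDeriv_le p n
    omega
  rw [leadingCoeff, hn, Nat.add_sub_cancel, taylor_coeff, eval_eq_sum_range' hdeg]
  simp [Finset.sum_range_succ, hasseDeriv_coeff, add_comm 1 n]

theorem comp_C_mul_X_add_C_eq_taylor_comp {R : Type*} [CommSemiring R] (p : R[X]) (b c : R) :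
    p.comp (C b * X + C c) = (taylor c p).comp (C b * X) := by
  rw [taylor_apply, comp_assoc]
  simp

theorem coeff_C_mul_X_add_C_comp {R : Type*} [CommSemiring R] (p : R[X]) (u v : R) {n : ℕ}
    (hn : n ≠ 0) : ((C u * X + C v).comp p).coeff n = u * p.coeff n := by
  simp [coeff_C, hn]

end Polynomial

/-- Proposition 2.2(a): two associate ϱ-polynomials have the same degree and
the same support. A ϱ-polynomial is a nonconstant polynomial whose coefficient
of `X^(d-1)` and constant coefficient vanish. -/
theorem associate_rho_polys_same_support {K : Type*} [Field K] [CharZero K]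
    (P Q α β : K[X])
    (hα : α.natDegree = 1) (hβ : β.natDegree = 1)
    (hassoc : Q = α.comp (P.comp β))
    (hP1 : 1 ≤ P.natDegree) (hPsub : P.coeff (P.natDegree - 1) = 0)
    (hP0 : P.coeff 0 = 0)
    (hQ1 : 1 ≤ Q.natDegree) (hQsub : Q.coeff (Q.natDegree - 1) = 0)
    (hQ0 : Q.coeff 0 = 0) :
    P.natDegree = Q.natDegree ∧ ∀ i : ℕ, (P.coeff i = 0 ↔ Q.coeff i = 0) := by
  obtain ⟨u, hu, v, rfl⟩ := natDegree_eq_one.mp hα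
  obtain ⟨b, hb, c, rfl⟩ := natDegree_eq_one.mp hβ
  have hdeg : Q.natDegree = P.natDegree := by
    rw [hassoc, natDegree_comp, natDegree_comp, hα, hβ, one_mul, mul_one]
  refine ⟨hdeg.symm, fun i => ?_⟩
  have hcoeff {n : ℕ} (hn : n ≠ 0) :
      Q.coeff n = u * ((taylor c P).coeff n * b ^ n) := by
    rw [hassoc, coeff_C_mul_X_add_C_comp _ _ _ hn, comp_C_mul_X_add_C_eq_taylor_comp,
      comp_C_mul_X_coeff]
  rcases eq_or_ne i 0 with rfl | hi
  · simp [hP0, hQ0]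
  rcases hP1.eq_or_lt with hd | hd
  · have hP : P.coeff 1 ≠ 0 := by
      rw [hd, coeff_natDegree, leadingCoeff_ne_zero]
      exact ne_zero_of_natDegree_gt hP1
    have hQ : Q.coeff 1 ≠ 0 := by
      rw [hd, ← hdeg, coeff_natDegree, leadingCoeff_ne_zero]
      exact ne_zero_of_natDegree_gt hQ1
    rcases eq_or_ne i 1 with rfl | hi1
    · simp [hP, hQ]
    · rw [coeff_eq_zero_of_natDegree_lt (by omega), coeff_eq_zero_of_natDegree_lt (by omega)]
  · have hlead : P.leadingCoeff ≠ 0 := leadingCoeff_ne_zero.mpr (ne_zero_of_natDegree_gt hP1)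
    have hnat : (P.natDegree : K) ≠ 0 := Nat.cast_ne_zero.mpr (by omega)
    have hc : c = 0 := by
      rw [hdeg, hcoeff (by omega), coeff_taylor_natDegree_sub_one _ _ hP1, hPsub] at hQsub
      simpa [hu, hb, hlead, hnat] using hQsub
    rw [hcoeff hi, hc, taylor_zero]
    simp [hu, hb]
end

section
/- For every polynomial P ∈ ℂ[X] of degree d ≥ 1 there exist polynomials α, β ∈ ℂ[X] of degree 1 such that α ∘ P ∘ β is a δ-polynomial. -/
open Polynomial

/-- A δ-polynomial of degree `d` is either `X^d`, or a monic polynomial of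
degree `d` with zero constant coefficient whose largest index `e < d` with
nonzero coefficient satisfies `1 ≤ e ≤ d - 2` and the coefficient of `X^e`
equals `d`. -/
def IsDeltaPoly {K : Type*} [Field K] (P : K[X]) : Prop :=
  P = X ^ P.natDegree ∨
  (P.Monic ∧ P.coeff 0 = 0 ∧ ∃ e : ℕ, 1 ≤ e ∧ e + 2 ≤ P.natDegree ∧
    P.coeff e = (P.natDegree : K) ∧ ∀ i : ℕ, e < i → i < P.natDegree → P.coeff i = 0)

lemma Polynomial.exists_taylor_coeff_natDegree_sub_one_eq_zero {K : Type*} [Field K] [CharZero K]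
    (P : K[X]) (hP : 1 ≤ P.natDegree) :
    ∃ t : K, (taylor t P).coeff (P.natDegree - 1) = 0 := by
  obtain ⟨n, hn⟩ : ∃ n, P.natDegree = n + 1 := ⟨P.natDegree - 1, by omega⟩
  have hlead : P.coeff (n + 1) ≠ 0 := by
    rw [← hn, coeff_natDegree, leadingCoeff_ne_zero]
    rintro rfl
    simp at hP
  have hn0 : (n : K) + 1 ≠ 0 := by exact_mod_cast n.succ_ne_zero
  have hdeg : (hasseDeriv n P).natDegree < 2 := by
    have := natDegree_hasseDeriv_le P n
    omega
  refine ⟨-P.coeff n / ((n + 1) * P.coeff (n + 1)), ?_⟩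
  rw [hn, Nat.add_sub_cancel, taylor_coeff, eval_eq_sum_range' hdeg]
  simp only [Finset.sum_range_succ, Finset.sum_range_zero, hasseDeriv_coeff, zero_add,
    Nat.choose_self, add_comm 1 n, Nat.choose_succ_self_right]
  push_cast
  field_simp
  ring

/-- Proposition 2.2(b), existence part: every `G`-orbit of a nonconstant complex
polynomial contains a δ-polynomial. -/
theorem exists_delta_poly_in_orbit (P : ℂ[X]) (hP : 1 ≤ P.natDegree) :
    ∃ α β : ℂ[X], α.natDegree = 1 ∧ β.natDegree = 1 ∧
      IsDeltaPoly (α.comp (P.comp β)) := by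
  obtain ⟨t, ht⟩ := P.exists_taylor_coeff_natDegree_sub_one_eq_zero hP
  set Q := taylor t P with hQ
  set d := P.natDegree with hd
  have hQd : Q.natDegree = d := natDegree_taylor P t
  have hlead : Q.coeff d ≠ 0 := by
    rw [← hQd, coeff_natDegree, leadingCoeff_ne_zero]
    intro h
    rw [h, natDegree_zero] at hQd
    omega
  have hd0 : (d : ℂ) ≠ 0 := by exact_mod_cast (by omega : d ≠ 0)
  have key (b : ℂ) (hb : b ≠ 0) : ∃ α β : ℂ[X], α.natDegree = 1 ∧ β.natDegree = 1 ∧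
      (α.comp (P.comp β)).natDegree = d ∧ (α.comp (P.comp β)).coeff 0 = 0 ∧
      ∀ n, n ≠ 0 → (α.comp (P.comp β)).coeff n = Q.coeff n * b ^ n / (Q.coeff d * b ^ d) := by
    have ha : (Q.coeff d * b ^ d)⁻¹ ≠ 0 := inv_ne_zero (mul_ne_zero hlead (pow_ne_zero _ hb))
    have hα : (C (Q.coeff d * b ^ d)⁻¹ * (X - C (Q.coeff 0))).natDegree = 1 := by
      rw [natDegree_C_mul ha, natDegree_X_sub_C]
    have hβ : (C b * X + C t).natDegree = 1 := natDegree_linear hb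
    have hcomp : P.comp (C b * X + C t) = Q.comp (C b * X) := by
      rw [hQ, taylor_apply, comp_assoc]
      simp
    refine ⟨_, _, hα, hβ, ?_, ?_, fun n hn => ?_⟩
    · rw [natDegree_comp, natDegree_comp, hα, hβ, one_mul, mul_one]
    · simp [hcomp, comp_C_mul_X_coeff, -mul_inv_rev]
    · rw [hcomp, mul_comp, C_comp, sub_comp, X_comp, C_comp, coeff_C_mul, coeff_sub,
        comp_C_mul_X_coeff, coeff_C_of_ne_zero hn, sub_zero]
      ring
  by_cases hex : ∃ e, 1 ≤ e ∧ e < d ∧ Q.coeff e ≠ 0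
  · obtain ⟨e, ⟨he1, hed, hec⟩, hmax⟩ : ∃ e, (1 ≤ e ∧ e < d ∧ Q.coeff e ≠ 0) ∧
        ∀ i, e < i → i < d → Q.coeff i = 0 := by
      obtain ⟨e₀, he₀⟩ := hex
      let p : ℕ → Prop := fun e => 1 ≤ e ∧ e < d ∧ Q.coeff e ≠ 0
      classical
      refine ⟨Nat.findGreatest p d, Nat.findGreatest_spec (P := p) he₀.2.1.le he₀,
        fun i hi hid => ?_⟩
      by_contra hc
      exact Nat.findGreatest_is_greatest hi hid.le ⟨by omega, hid, hc⟩
    have hne : e ≠ d - 1 := by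
      rintro rfl
      exact hec ht
    obtain ⟨b, hb⟩ := IsAlgClosed.exists_pow_nat_eq (Q.coeff e / (d * Q.coeff d))
      (by omega : 0 < d - e)
    have hb0 : b ≠ 0 := by
      rintro rfl
      rw [zero_pow (by omega)] at hb
      exact div_ne_zero hec (mul_ne_zero hd0 hlead) hb.symm
    obtain ⟨α, β, hα, hβ, hdeg, h0, hcoeff⟩ := key b hb0
    refine ⟨α, β, hα, hβ, Or.inr ⟨?_, h0, e, he1, by omega, ?_, fun i hei hid => ?_⟩⟩
    · rw [Monic, leadingCoeff, hdeg, hcoeff d (by omega)]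
      exact div_self (mul_ne_zero hlead (pow_ne_zero _ hb0))
    · have hbd : b ^ d = b ^ (d - e) * b ^ e := by rw [← pow_add, Nat.sub_add_cancel hed.le]
      rw [hdeg, hcoeff e (by omega), hbd, hb]
      field_simp
    · rw [hcoeff i (by omega), hmax i hei (by omega), zero_mul, zero_div]
  · obtain ⟨α, β, hα, hβ, hdeg, h0, hcoeff⟩ := key 1 one_ne_zero
    refine ⟨α, β, hα, hβ, Or.inl ?_⟩
    ext n
    rw [hdeg, coeff_X_pow]
    rcases Nat.eq_zero_or_pos n with rfl | hn
    · rw [h0, if_neg (by omega)]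
    rcases lt_trichotomy n d with h | h | h
    · have hn0 : Q.coeff n = 0 := by
        by_contra hc
        exact hex ⟨n, hn, h, hc⟩
      rw [hcoeff n hn.ne', hn0, if_neg h.ne, zero_mul, zero_div]
    · rw [hcoeff n hn.ne', if_pos h, h, one_pow, mul_one, div_self hlead]
    · rw [coeff_eq_zero_of_natDegree_lt (hdeg.trans_lt h), if_neg h.ne']
end

section
/- Let F ∈ ℂ[X] and suppose F = P_1 ∘ P_2 ∘ … ∘ P_s = Q_1 ∘ Q_2 ∘ … ∘ Q_t, where every P_i and every Q_j is an indecomposable polynomial in ℂ[X]. Then s = t. -/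
open Polynomial

/-- A polynomial of degree at least 2 is indecomposable if it is not the
composition of two polynomials of degree at least 2. -/
def Indecomposable (P : ℂ[X]) : Prop :=
  2 ≤ P.natDegree ∧
    ¬ ∃ Q R : ℂ[X], 2 ≤ Q.natDegree ∧ 2 ≤ R.natDegree ∧ P = Q.comp R

namespace Ritt

/-- The field of formal Laurent series in a local parameter at infinity. -/
abbrev InftyField : Type := FractionRing (PowerSeries ℂ)

local notation "𝓡" => PowerSeries ℂ
local notation "𝓛" => InftyField

/-- The local parameter at infinity. -/
noncomputable def param : 𝓛 := algebraMap 𝓡 𝓛 PowerSeries.X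

/-- The embedding of the constants. -/
noncomputable def const : ℂ →+* 𝓛 := (algebraMap 𝓡 𝓛).comp PowerSeries.C

lemma param_ne_zero : param ≠ 0 := by
  simp [param, PowerSeries.X_ne_zero]

lemma rescale_injective (ξ : ℂˣ) : Function.Injective (PowerSeries.rescale (ξ : ℂ)) := by
  intro f g h
  simpa [PowerSeries.rescale_rescale, PowerSeries.rescale_one] using
    congrArg (PowerSeries.rescale ((ξ⁻¹ : ℂˣ) : ℂ)) h

/-- The automorphism `t ↦ ξ t` of the field of Laurent series. -/
noncomputable def rot (ξ : ℂˣ) : 𝓛 →+* 𝓛 :=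
  IsFractionRing.lift (g := (algebraMap 𝓡 𝓛).comp (PowerSeries.rescale (ξ : ℂ)))
    ((IsFractionRing.injective 𝓡 𝓛).comp (rescale_injective ξ))

lemma rot_algebraMap (ξ : ℂˣ) (w : 𝓡) :
    rot ξ (algebraMap 𝓡 𝓛 w) = algebraMap 𝓡 𝓛 (PowerSeries.rescale (ξ : ℂ) w) :=
  IsFractionRing.lift_algebraMap _ _

lemma rot_const (ξ : ℂˣ) (c : ℂ) : rot ξ (const c) = const c := by
  simp only [const, RingHom.comp_apply, rot_algebraMap]
  congr 1
  ext n
  simp only [PowerSeries.coeff_rescale, PowerSeries.coeff_C]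
  split_ifs with h <;> simp [h]

lemma rot_param (ξ : ℂˣ) : rot ξ param = const ξ * param := by
  simp [param, const, rot_algebraMap, PowerSeries.rescale_X]

lemma rot_mul (ξ η : ℂˣ) (y : 𝓛) : rot (ξ * η) y = rot ξ (rot η y) := by
  obtain ⟨a, b, -, rfl⟩ := IsFractionRing.div_surjective (A := 𝓡) y
  simp only [map_div₀, rot_algebraMap, PowerSeries.rescale_rescale, Units.val_mul, mul_comm]

lemma rot_one (y : 𝓛) : rot 1 y = y := by
  obtain ⟨a, b, -, rfl⟩ := IsFractionRing.div_surjective (A := 𝓡) y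
  simp [map_div₀, rot_algebraMap, PowerSeries.rescale_one]

/-- `y` has a pole of order exactly `m` at infinity. -/
def HasPole (y : 𝓛) (m : ℕ) : Prop :=
  ∃ w : 𝓡, PowerSeries.constantCoeff w ≠ 0 ∧ y * param ^ m = algebraMap 𝓡 𝓛 w

namespace HasPole

variable {y z : 𝓛} {m k : ℕ}

lemma one : HasPole 1 0 := ⟨1, by simp, by simp⟩

lemma neg (hy : HasPole y m) : HasPole (-y) m := by
  obtain ⟨w, hw, h⟩ := hy
  exact ⟨-w, by simpa using hw, by rw [neg_mul, h, map_neg]⟩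

lemma ne_zero (hy : HasPole y m) : y ≠ 0 := by
  rintro rfl
  obtain ⟨w, hw, h⟩ := hy
  rw [zero_mul, eq_comm, FaithfulSMul.algebraMap_eq_zero_iff] at h
  simp [h] at hw

lemma mul (hy : HasPole y m) (hz : HasPole z k) : HasPole (y * z) (m + k) := by
  obtain ⟨v, hv, h⟩ := hy
  obtain ⟨w, hw, h'⟩ := hz
  refine ⟨v * w, by simp [hv, hw], ?_⟩
  rw [map_mul, ← h, ← h']
  ring

lemma prod {α : Type*} (s : Finset α) (f : α → 𝓛) (hf : ∀ i ∈ s, HasPole (f i) m) :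
    HasPole (∏ i ∈ s, f i) (s.card * m) := by
  classical
  induction s using Finset.induction_on with
  | empty => simpa using one
  | insert a s ha ih =>
    rw [Finset.prod_insert ha, Finset.card_insert_of_notMem ha, add_mul, one_mul, add_comm]
    exact (hf a (by simp)).mul (ih fun i hi => hf i (by simp [hi]))

lemma rot (hy : HasPole y m) (ξ : ℂˣ) : HasPole (rot ξ y) m := by
  obtain ⟨w, hw, h⟩ := hy
  refine ⟨PowerSeries.C ((ξ⁻¹ : ℂˣ) : ℂ) ^ m * PowerSeries.rescale (ξ : ℂ) w, ?_, ?_⟩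
  · simp only [map_mul, map_pow, PowerSeries.constantCoeff_C]
    rw [← PowerSeries.coeff_zero_eq_constantCoeff_apply, PowerSeries.coeff_rescale]
    simpa using hw
  · rw [map_mul, ← rot_algebraMap, ← h, map_mul, map_pow, map_pow, rot_param]
    change _ = const _ ^ m * _
    have : const ((ξ⁻¹ : ℂˣ) : ℂ) * const ξ = 1 := by simp
    calc _ = (const ((ξ⁻¹ : ℂˣ) : ℂ) * const ξ) ^ m * (Ritt.rot ξ y * param ^ m) := by
          rw [this]; ring
      _ = _ := by ring

lemma order_unique (hy : HasPole y m) (hy' : HasPole y k) : m = k := by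
  wlog hmk : m ≤ k generalizing m k
  · exact (this hy' hy (by omega)).symm
  obtain ⟨v, hv, h⟩ := hy
  obtain ⟨w, hw, h'⟩ := hy'
  by_contra hne
  obtain ⟨j, rfl⟩ : ∃ j, k = m + (j + 1) := ⟨k - m - 1, by omega⟩
  rw [pow_add, ← mul_assoc, h, param, ← map_pow, ← map_mul] at h'
  rw [← IsFractionRing.injective 𝓡 𝓛 h'] at hw
  simp at hw

lemma pow_eq_one (hy : HasPole y m) {ξ : ℂˣ} (h : Ritt.rot ξ y = y) : ξ ^ m = 1 := by
  obtain ⟨w, hw, hyw⟩ := hy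
  have h1 := congrArg (Ritt.rot ξ) hyw
  rw [map_mul, h, map_pow, rot_param, mul_pow, mul_left_comm, hyw, rot_algebraMap,
    const, RingHom.comp_apply, ← map_pow, ← map_mul] at h1
  have h2 := congrArg PowerSeries.constantCoeff (IsFractionRing.injective 𝓡 𝓛 h1)
  rw [← PowerSeries.coeff_zero_eq_constantCoeff_apply (PowerSeries.rescale _ _),
    PowerSeries.coeff_rescale] at h2
  simp only [map_mul, map_pow, PowerSeries.constantCoeff_C, pow_zero, one_mul,
    PowerSeries.coeff_zero_eq_constantCoeff] at h2
  exact Units.ext (by simpa using mul_right_cancel₀ hw (h2.trans (one_mul _).symm))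

end HasPole

lemma map_scaleRoots_constantCoeff (A : ℂ[X]) {s : 𝓡} (hs : PowerSeries.constantCoeff s = 0) :
    ((A.map PowerSeries.C).scaleRoots s).map (PowerSeries.constantCoeff (R := ℂ)) =
      C A.leadingCoeff * X ^ A.natDegree := by
  by_cases hA : A = 0
  · simp [hA]
  have hinj : Function.Injective (PowerSeries.C (R := ℂ)) := PowerSeries.C_injective
  rw [map_scaleRoots, hs, Polynomial.map_map]
  · have : (PowerSeries.constantCoeff (R := ℂ)).comp PowerSeries.C = RingHom.id ℂ := by
      ext; simp
    rw [this, Polynomial.map_id, scaleRoots_zero, smul_eq_C_mul]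
  · rw [leadingCoeff_map_of_injective hinj]
    simpa using hA

lemma constantCoeff_eval_scaleRoots (A : ℂ[X]) {s : 𝓡} (hs : PowerSeries.constantCoeff s = 0)
    (w : 𝓡) :
    PowerSeries.constantCoeff (((A.map PowerSeries.C).scaleRoots s).eval w) =
      A.leadingCoeff * PowerSeries.constantCoeff w ^ A.natDegree := by
  rw [← Polynomial.eval_map_apply, map_scaleRoots_constantCoeff A hs]
  simp

lemma constantCoeff_eval_derivative_scaleRoots (A : ℂ[X]) {s : 𝓡}
    (hs : PowerSeries.constantCoeff s = 0) (w : 𝓡) :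
    PowerSeries.constantCoeff ((derivative ((A.map PowerSeries.C).scaleRoots s)).eval w) =
      A.leadingCoeff * (A.natDegree * PowerSeries.constantCoeff w ^ (A.natDegree - 1)) := by
  rw [← Polynomial.eval_map_apply, ← derivative_map, map_scaleRoots_constantCoeff A hs]
  simp [derivative_X_pow]

lemma algebraMap_eval_scaleRoots (A : ℂ[X]) {y : 𝓛} {m : ℕ} {w : 𝓡}
    (h : y * param ^ m = algebraMap 𝓡 𝓛 w) :
    algebraMap 𝓡 𝓛 (((A.map PowerSeries.C).scaleRoots (PowerSeries.X ^ m)).eval w) =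
      A.eval₂ const y * param ^ (m * A.natDegree) := by
  have hinj : Function.Injective (PowerSeries.C (R := ℂ)) := PowerSeries.C_injective
  have := scaleRoots_eval₂_mul (p := A.map PowerSeries.C) (algebraMap 𝓡 𝓛) y (PowerSeries.X ^ m)
  rw [map_pow, ← param, mul_comm _ y, h, eval₂_at_apply, eval₂_map,
    natDegree_map_eq_of_injective hinj] at this
  rw [this, ← pow_mul, mul_comm]
  rfl

lemma HasPole.eval₂ {y : 𝓛} {m : ℕ} (hy : HasPole y m) (hm : m ≠ 0) {A : ℂ[X]} (hA : A ≠ 0) :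
    HasPole (A.eval₂ const y) (m * A.natDegree) := by
  obtain ⟨w, hw, h⟩ := hy
  refine ⟨_, ?_, (algebraMap_eval_scaleRoots A h).symm⟩
  rw [constantCoeff_eval_scaleRoots A (by simp [hm])]
  simp [hA, hw]

/-- If `A(y)` is invariant under `rot ξ` and `ξ` fixes the leading term of `y`, then it fixes
`y`. -/
lemma HasPole.rot_eq_of_eval₂ {y : 𝓛} {m : ℕ} (hy : HasPole y m) (hm : m ≠ 0) {A : ℂ[X]}
    (hA : A.natDegree ≠ 0) {ξ : ℂˣ} (hξ : ξ ^ m = 1)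
    (h : Ritt.rot ξ (A.eval₂ const y) = A.eval₂ const y) : Ritt.rot ξ y = y := by
  obtain ⟨w, hw, hyw⟩ := hy
  have hrot : Ritt.rot ξ y * param ^ m = algebraMap 𝓡 𝓛 (PowerSeries.rescale (ξ : ℂ) w) := by
    have : const (ξ : ℂ) ^ m = 1 := by rw [← map_pow, ← Units.val_pow_eq_pow_val, hξ]; simp
    rw [← rot_algebraMap, ← hyw, map_mul, map_pow, rot_param, mul_pow, this, one_mul]
  have hs : PowerSeries.constantCoeff (PowerSeries.X ^ m : 𝓡) = 0 := by simp [hm]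
  have h' : A.eval₂ const (Ritt.rot ξ y) = A.eval₂ const y := by
    rw [← h, hom_eval₂]
    congr 1
    ext c
    exact (rot_const ξ c).symm
  have e1 := algebraMap_eval_scaleRoots A hyw
  have e2 := algebraMap_eval_scaleRoots A hrot
  rw [h', ← e1] at e2
  have e3 := IsFractionRing.injective 𝓡 𝓛 e2
  set Q := (A.map PowerSeries.C).scaleRoots (PowerSeries.X ^ m : 𝓡)
  have hc : PowerSeries.constantCoeff (PowerSeries.rescale (ξ : ℂ) w) =
        PowerSeries.constantCoeff w := by
      rw [← PowerSeries.coeff_zero_eq_constantCoeff_apply, PowerSeries.coeff_rescale]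
      simp
  have e4 : PowerSeries.rescale (ξ : ℂ) w = w := by
    refine IsLocalRing.eq_of_eval_eq_zero_of_not_isUnit_sub
      (f := Q - C (Q.eval w)) ?_ ?_ ?_ ?_
    · simp [e3]
    · simp
    · rw [PowerSeries.isUnit_iff_constantCoeff]
      simp [hc]
    · rw [PowerSeries.isUnit_iff_constantCoeff]
      rw [derivative_sub, derivative_C, sub_zero, constantCoeff_eval_derivative_scaleRoots A hs]
      have : A ≠ 0 := by rintro rfl; simp at hA
      simp [this, hA, hc, hw]
  rw [e4, ← hyw] at hrot
  exact mul_right_cancel₀ (pow_ne_zero _ param_ne_zero) hrot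

/-- A polynomial `F` of degree `n ≥ 1` has a point at infinity `x` with `F(x) = t⁻ⁿ`. -/
lemma exists_point {F : ℂ[X]} (hF : F.natDegree ≠ 0) :
    ∃ x : 𝓛, HasPole x 1 ∧ F.eval₂ const x * param ^ F.natDegree = 1 := by
  have hF0 : F ≠ 0 := by rintro rfl; simp at hF
  have hlc : F.leadingCoeff ≠ 0 := by simpa using hF0
  have hinj : Function.Injective (PowerSeries.C (R := ℂ)) := PowerSeries.C_injective
  have hs : PowerSeries.constantCoeff (PowerSeries.X ^ 1 : 𝓡) = 0 := by simp
  obtain ⟨c, hc⟩ := IsAlgClosed.exists_pow_nat_eq F.leadingCoeff⁻¹ (Nat.pos_of_ne_zero hF)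
  have hc0 : c ≠ 0 := by
    rintro rfl
    rw [zero_pow hF] at hc
    exact hlc (inv_eq_zero.mp hc.symm)
  set Q := (F.map PowerSeries.C).scaleRoots (PowerSeries.X ^ 1 : 𝓡) with hQ
  have hQd : Q.natDegree = F.natDegree := by
    rw [hQ, natDegree_scaleRoots, natDegree_map_eq_of_injective hinj]
  have hmem : ∀ w : 𝓡, w ∈ Ideal.span {(PowerSeries.X : 𝓡)} ↔
      PowerSeries.constantCoeff w = 0 := fun w => by
    rw [Ideal.mem_span_singleton, PowerSeries.X_dvd_iff]
  have hmonic : (C (PowerSeries.C F.leadingCoeff⁻¹) * (Q - 1)).Monic := by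
    have hd : (Q - 1).natDegree = F.natDegree := by
      rw [← C_1, natDegree_sub_C, hQd]
    rw [Monic, leadingCoeff, natDegree_C_mul, hd, coeff_C_mul, coeff_sub, coeff_one, if_neg hF,
      sub_zero, ← hQd, coeff_natDegree, hQ, leadingCoeff_scaleRoots,
      leadingCoeff_map_of_injective hinj, ← map_mul, inv_mul_cancel₀ hlc, map_one]
    simpa using hF0
  obtain ⟨u, hu, hu'⟩ := HenselianRing.is_henselian (I := Ideal.span {(PowerSeries.X : 𝓡)})
    _ hmonic (PowerSeries.C c) (by
      rw [hmem]
      simp only [eval_mul, eval_C, eval_sub, eval_one, map_mul, map_sub, map_one,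
        PowerSeries.constantCoeff_C]
      rw [constantCoeff_eval_scaleRoots F hs]
      simp [hc, hlc]) (by
      refine IsUnit.map _ ?_
      rw [PowerSeries.isUnit_iff_constantCoeff]
      simp only [derivative_C_mul, derivative_sub, derivative_one, sub_zero, eval_mul, eval_C,
        map_mul, PowerSeries.constantCoeff_C]
      rw [constantCoeff_eval_derivative_scaleRoots F hs]
      simp [hc0, hF, hF0])
  have hu0 : PowerSeries.constantCoeff u = c := by
    rw [hmem] at hu'
    simpa [sub_eq_zero] using hu'
  have hx : algebraMap 𝓡 𝓛 u / param * param ^ 1 = algebraMap 𝓡 𝓛 u := by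
    rw [pow_one, div_mul_cancel₀ _ param_ne_zero]
  refine ⟨algebraMap 𝓡 𝓛 u / param, ⟨u, by rw [hu0]; exact hc0, hx⟩, ?_⟩
  have hQu : Q.eval u = 1 := by
    rw [IsRoot.def, eval_mul, eval_C] at hu
    have := (mul_eq_zero.mp hu).resolve_left (by simpa using hF0)
    simpa [sub_eq_zero] using this
  have := algebraMap_eval_scaleRoots F hx
  rw [← hQ, hQu, map_one, one_mul] at this
  exact this.symm

noncomputable instance (m : ℕ) [NeZero m] : Fintype (rootsOfUnity m ℂ) := Fintype.ofFinite _

lemma card_rootsOfUnity (m : ℕ) [NeZero m] : Fintype.card (rootsOfUnity m ℂ) = m := by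
  rw [← Nat.card_eq_fintype_card, Complex.card_rootsOfUnity]

lemma hasPole_const {c : ℂ} (hc : c ≠ 0) : HasPole (const c) 0 :=
  ⟨PowerSeries.C c, by simpa using hc, by simp [const]⟩

lemma rot_eval₂ (ξ : ℂˣ) (P : ℂ[X]) (y : 𝓛) :
    rot ξ (P.eval₂ const y) = P.eval₂ const (rot ξ y) := by
  rw [hom_eval₂]
  congr 1
  ext c
  exact rot_const ξ c

/-- The polynomials `P` such that `P(x)` is fixed by `rot ξ` for all `m`-th roots of unity `ξ`. -/
noncomputable def invariants (x : 𝓛) (m : ℕ) : Subalgebra ℂ ℂ[X] where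
  carrier := {P | ∀ ξ : ℂˣ, ξ ^ m = 1 → rot ξ (P.eval₂ const x) = P.eval₂ const x}
  mul_mem' hP hQ ξ hξ := by rw [eval₂_mul, map_mul, hP ξ hξ, hQ ξ hξ]
  add_mem' hP hQ ξ hξ := by rw [eval₂_add, map_add, hP ξ hξ, hQ ξ hξ]
  algebraMap_mem' c ξ _ := by rw [algebraMap_eq, eval₂_C, rot_const]

lemma invariants_mono (x : 𝓛) {m k : ℕ} (h : m ∣ k) : invariants x k ≤ invariants x m := by
  obtain ⟨j, rfl⟩ := h
  intro P hP ξ hξ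
  exact hP ξ (by rw [pow_mul, hξ, one_pow])

lemma mem_invariants_of_eval₂_mul {x : 𝓛} {F : ℂ[X]} {n : ℕ}
    (h : F.eval₂ const x * param ^ n = 1) : F ∈ invariants x n := by
  intro ξ hξ
  have hrot := congrArg (rot ξ) h
  have : const (ξ : ℂ) ^ n = 1 := by rw [← map_pow, ← Units.val_pow_eq_pow_val, hξ]; simp
  rw [map_mul, map_pow, rot_param, mul_pow, this, one_mul, map_one, ← h] at hrot
  exact mul_right_cancel₀ (pow_ne_zero _ param_ne_zero) hrot

/-- Over an integrally closed domain `R`, the greatest common divisor of a monic polynomial and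
another polynomial is represented by a monic polynomial over `R`. -/
lemma exists_monic_dvd_of_common_roots {R L : Type*} [CommRing R] [IsDomain R]
    [IsIntegrallyClosed R] [Field L] (ψ : R →+* L) (hψ : Function.Injective ψ) {f : R[X]}
    (hf : f.Monic) (h : R[X]) :
    ∃ q : R[X], q.Monic ∧ q.map ψ ∣ f.map ψ ∧
      ∀ y, (q.map ψ).eval y = 0 ↔ (f.map ψ).eval y = 0 ∧ (h.map ψ).eval y = 0 := by
  classical
  let K := FractionRing R
  obtain ⟨φ, hφ⟩ : ∃ φ : K →+* L, φ.comp (algebraMap R K) = ψ :=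
    ⟨IsFractionRing.lift hψ, RingHom.ext fun r => IsFractionRing.lift_algebraMap hψ r⟩
  set Φ : K[X] := EuclideanDomain.gcd (f.map (algebraMap R K)) (h.map (algebraMap R K)) with hΦ
  have hdvd : Φ ∣ f.map (algebraMap R K) := EuclideanDomain.gcd_dvd_left _ _
  have hΦlc : Φ.leadingCoeff ≠ 0 :=
    leadingCoeff_ne_zero.mpr (ne_zero_of_dvd_ne_zero (hf.map _).ne_zero hdvd)
  obtain ⟨q, hq⟩ := IsIntegrallyClosed.eq_map_mul_C_of_dvd K hf hdvd
  have hqmon : (q.map (algebraMap R K)).Monic := by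
    have := congrArg leadingCoeff hq
    rw [leadingCoeff_mul, leadingCoeff_C] at this
    exact mul_right_cancel₀ hΦlc (this.trans (one_mul _).symm)
  have hqψ : q.map ψ = (q.map (algebraMap R K)).map φ := by rw [Polynomial.map_map, hφ]
  have hMΦ : Φ.map φ = q.map ψ * C (φ Φ.leadingCoeff) := by
    conv_lhs => rw [← hq]
    rw [Polynomial.map_mul, ← hqψ, map_C]
  refine ⟨q, monic_of_injective (IsFractionRing.injective R K) hqmon, ?_, fun y => ?_⟩
  · rw [← hφ, ← Polynomial.map_map, ← Polynomial.map_map]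
    exact Polynomial.map_dvd φ (dvd_trans ⟨_, hq.symm⟩ hdvd)
  · have h1 : (q.map ψ).eval y = 0 ↔ Φ.eval₂ φ y = 0 := by
      rw [← eval_map, hMΦ, eval_mul, eval_C, mul_eq_zero,
        or_iff_left ((map_ne_zero φ).mpr hΦlc)]
    rw [h1, hΦ, root_gcd_iff_root_left_right, ← eval_map, ← eval_map, Polynomial.map_map,
      Polynomial.map_map, hφ]

lemma rot_prod_rot {m : ℕ} [NeZero m] (y : 𝓛) {η : ℂˣ} (hη : η ^ m = 1) :
    rot η (∏ ξ : rootsOfUnity m ℂ, rot (ξ : ℂˣ) y) = ∏ ξ : rootsOfUnity m ℂ, rot (ξ : ℂˣ) y := by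
  rw [map_prod]
  refine Fintype.prod_equiv (Equiv.mulLeft ⟨η, (mem_rootsOfUnity _ _).mpr hη⟩) _ _ fun ξ => ?_
  simp [rot_mul]

lemma monic_C_mul_map_sub {P : ℂ[X]} (hP : P.natDegree ≠ 0) :
    (C (C P.leadingCoeff⁻¹) * (P.map C - C P)).Monic := by
  have hP0 : P ≠ 0 := by rintro rfl; simp at hP
  have hlc : (P.map C - C P).leadingCoeff = C P.leadingCoeff := by
    rw [leadingCoeff_sub_of_degree_lt, leadingCoeff_map_of_injective C_injective]
    refine degree_C_le.trans_lt ?_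
    rw [degree_map_eq_of_injective C_injective, ← natDegree_pos_iff_degree_pos]
    omega
  rw [Monic, leadingCoeff_mul, leadingCoeff_C, hlc, ← map_mul,
    inv_mul_cancel₀ (leadingCoeff_ne_zero.mpr hP0), map_one]

lemma isRoot_prod_iff {m : ℕ} [NeZero m] {x y : 𝓛} :
    (∏ ξ : rootsOfUnity m ℂ, (X - C (rot (ξ : ℂˣ) x))).eval y = 0 ↔
      ∃ ξ : ℂˣ, ξ ^ m = 1 ∧ y = rot ξ x := by
  simp [eval_prod, Finset.prod_eq_zero_iff, sub_eq_zero, ← mem_rootsOfUnity]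

section Point

variable {x : 𝓛} (hx : HasPole x 1)

include hx

lemma hasPole_eval₂ {P : ℂ[X]} (hP : P ≠ 0) : HasPole (P.eval₂ const x) P.natDegree := by
  simpa using hx.eval₂ one_ne_zero hP

lemma eval₂_injective : Function.Injective (eval₂RingHom const x) := by
  rw [injective_iff_map_eq_zero]
  intro P hP
  by_contra h
  exact (hasPole_eval₂ hx h).ne_zero hP

lemma right_factor_mem_invariants {F A P : ℂ[X]} (hF : F ∈ invariants x F.natDegree)
    (h : F = A.comp P) (hA : A.natDegree ≠ 0) (hP : P.natDegree ≠ 0) :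
    P ∈ invariants x P.natDegree := by
  have hP0 : P ≠ 0 := by rintro rfl; simp at hP
  intro ξ hξ
  refine (hasPole_eval₂ hx hP0).rot_eq_of_eval₂ hP hA hξ ?_
  rw [← eval₂_comp, ← h]
  refine hF ξ ?_
  rw [h, natDegree_comp, mul_comm, pow_mul, hξ, one_pow]

lemma dvd_natDegree_of_mem_invariants {m : ℕ} (hm : m ≠ 0) {P : ℂ[X]}
    (hP : P ∈ invariants x m) : m ∣ P.natDegree := by
  by_cases hP0 : P = 0
  · simp [hP0]
  have hζ := (Complex.isPrimitiveRoot_exp m hm).isUnit_unit hm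
  exact hζ.dvd_of_pow_eq_one _
    ((hasPole_eval₂ hx hP0).pow_eq_one (hP _ hζ.pow_eq_one))

lemma rot_injective : Function.Injective fun ξ : ℂˣ => rot ξ x := by
  intro ξ η h
  have h' : rot (η⁻¹ * ξ) x = x := by
    rw [rot_mul]
    change rot ξ x = rot η x at h
    rw [h, ← rot_mul, inv_mul_cancel, rot_one]
  have := hx.pow_eq_one h'
  rw [pow_one] at this
  exact (inv_mul_eq_one.mp this).symm

lemma rot_subtype_injective (m : ℕ) :
    Function.Injective fun ξ : rootsOfUnity m ℂ => rot (ξ : ℂˣ) x :=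
  (rot_injective hx).comp Subtype.val_injective

lemma map_sub_eq_prod {P : ℂ[X]} {m : ℕ} [NeZero m] (hm : P.natDegree = m)
    (hP : P ∈ invariants x m) :
    P.map const - C (P.eval₂ const x) =
      C (const P.leadingCoeff) * ∏ ξ : rootsOfUnity m ℂ, (X - C (rot (ξ : ℂˣ) x)) := by
  have hm0 : m ≠ 0 := NeZero.ne m
  have hdeg : (P.map const - C (P.eval₂ const x)).natDegree = m := by
    rw [natDegree_sub_C, natDegree_map, hm]
  have hlc : (P.map const - C (P.eval₂ const x)).leadingCoeff = const P.leadingCoeff := by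
    rw [leadingCoeff_sub_of_degree_lt, leadingCoeff_map]
    refine degree_C_le.trans_lt ?_
    rw [degree_map, ← natDegree_pos_iff_degree_pos]
    omega
  rw [← hlc]
  refine eq_leadingCoeff_mul_of_monic_of_dvd_of_natDegree_le
    (monic_prod_of_monic _ _ fun _ _ => monic_X_sub_C _) ?_ ?_
  · refine Finset.prod_dvd_of_coprime
      (fun ξ _ η _ h => pairwise_coprime_X_sub_C (rot_subtype_injective hx m) h) ?_
    intro ξ _
    rw [dvd_iff_isRoot, IsRoot.def, eval_sub, eval_C, eval_map, ← rot_eval₂, sub_eq_zero]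
    exact hP _ ((mem_rootsOfUnity _ _).mp ξ.2)
  · rw [hdeg, natDegree_prod_of_monic _ _ fun _ _ => monic_X_sub_C _]
    simp [card_rootsOfUnity]

lemma natDegree_eq_of_hasPole {P : ℂ[X]} {m : ℕ} (h : HasPole (P.eval₂ const x) m) :
    P.natDegree = m := by
  refine (hasPole_eval₂ hx ?_).order_unique h
  rintro rfl
  exact h.ne_zero (by simp)

/-- If `B` and `D` are invariant under rotations of orders `deg B` and `deg D` that are coprime,
then the norm of `D` over `ℂ[B]` is a common invariant of degree `deg B * deg D`. -/
lemma exists_invariant_lcm {B D : ℂ[X]} (hB : B ∈ invariants x B.natDegree)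
    (hD : D ∈ invariants x D.natDegree) (hB0 : B.natDegree ≠ 0) (hD0 : D.natDegree ≠ 0) :
    ∃ H : ℂ[X], H ∈ invariants x B.natDegree ∧ H ∈ invariants x D.natDegree ∧
      H.natDegree = B.natDegree * D.natDegree := by
  have : NeZero B.natDegree := ⟨hB0⟩
  have hBne : B ≠ 0 := by rintro rfl; simp at hB0
  have hDne : D ≠ 0 := by rintro rfl; simp at hD0
  have hlc : const B.leadingCoeff ≠ 0 := by simpa using hBne
  set ψ : ℂ[X] →+* 𝓛 := eval₂RingHom const x with hψ
  have hψC : ψ.comp C = const := by ext c; simp [hψ]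
  obtain ⟨H, hH⟩ : ∃ H : ℂ[X], H.eval₂ const x = const (B.leadingCoeff ^ D.natDegree) *
      ∏ ξ : rootsOfUnity B.natDegree ℂ, rot (ξ : ℂˣ) (D.eval₂ const x) := by
    refine ⟨resultant (B.map C - C B) (D.map C) B.natDegree D.natDegree, ?_⟩
    change ψ _ = _
    rw [← resultant_map_map, Polynomial.map_sub, Polynomial.map_map, Polynomial.map_map, hψC,
      map_C]
    change resultant (B.map const - C (B.eval₂ const x)) _ _ _ = _
    have hs : (B.map const - C (B.eval₂ const x)).Splits := by
      rw [map_sub_eq_prod hx rfl hB]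
      exact (Splits.C _).mul (Splits.prod fun _ _ => Splits.X_sub_C _)
    have hdeg : (B.map const - C (B.eval₂ const x)).natDegree = B.natDegree := by
      rw [natDegree_sub_C, natDegree_map]
    have := resultant_eq_prod_eval _ (D.map const) D.natDegree natDegree_map_le hs
    rw [hdeg] at this
    rw [this, map_sub_eq_prod hx rfl hB, roots_C_mul _ hlc, leadingCoeff_mul, leadingCoeff_C,
      (monic_prod_of_monic _ _ fun _ _ => monic_X_sub_C _ : Monic _).leadingCoeff, mul_one,
      roots_prod _ _ (Finset.prod_ne_zero_iff.mpr fun _ _ => X_sub_C_ne_zero _), map_pow]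
    simp [rot_eval₂, eval_map]
  refine ⟨H, fun η hη => ?_, fun η hη => ?_, ?_⟩
  · rw [hH, map_mul, rot_const, rot_prod_rot _ hη]
  · rw [hH, map_mul, rot_const, map_prod]
    congr 1
    refine Finset.prod_congr rfl fun ξ _ => ?_
    rw [← rot_mul, mul_comm, rot_mul, hD η hη]
  · refine natDegree_eq_of_hasPole hx ?_
    rw [hH]
    have := (hasPole_const (pow_ne_zero D.natDegree (leadingCoeff_ne_zero.mpr hBne))).mul
      (HasPole.prod Finset.univ
        (fun ξ : rootsOfUnity B.natDegree ℂ => rot (ξ : ℂˣ) (D.eval₂ const x))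
        fun ξ _ => (hasPole_eval₂ hx hDne).rot ξ)
    simpa [card_rootsOfUnity] using this

lemma map_C_mul_map_sub {P : ℂ[X]} {m : ℕ} [NeZero m] (hm : P.natDegree = m)
    (hP : P ∈ invariants x m) :
    (C (C P.leadingCoeff⁻¹) * (P.map C - C P)).map (eval₂RingHom const x) =
      ∏ ξ : rootsOfUnity m ℂ, (X - C (rot (ξ : ℂˣ) x)) := by
  have hP0 : const P.leadingCoeff ≠ 0 := by
    have := NeZero.ne m
    have : P ≠ 0 := by rintro rfl; simp at hm; omega
    simpa using this
  have hC : (eval₂RingHom const x).comp C = const := by ext c; simp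
  rw [Polynomial.map_mul, Polynomial.map_sub, Polynomial.map_map, hC, map_C, map_C]
  simp only [coe_eval₂RingHom, eval₂_C]
  rw [map_sub_eq_prod hx hm hP, ← mul_assoc, ← map_mul, map_inv₀, inv_mul_cancel₀ hP0, map_one,
    one_mul]

/-- The constant term of the greatest common divisor of `B(Y) - B(x)` and `D(Y) - D(x)` is a
common invariant of degree `gcd (deg B) (deg D)`. -/
lemma exists_invariant_gcd {B D : ℂ[X]} (hB : B ∈ invariants x B.natDegree)
    (hD : D ∈ invariants x D.natDegree) (hB0 : B.natDegree ≠ 0) (hD0 : D.natDegree ≠ 0) :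
    ∃ G : ℂ[X], G ∈ invariants x (B.natDegree.gcd D.natDegree) ∧
      G.natDegree = B.natDegree.gcd D.natDegree := by
  classical
  have : NeZero B.natDegree := ⟨hB0⟩
  have : NeZero D.natDegree := ⟨hD0⟩
  set g := B.natDegree.gcd D.natDegree with hg
  have : NeZero g := ⟨(Nat.gcd_pos_of_pos_left _ (Nat.pos_of_ne_zero hB0)).ne'⟩
  set ψ : ℂ[X] →+* 𝓛 := eval₂RingHom const x with hψ
  have hψi : Function.Injective ψ := eval₂_injective hx
  set fB : ℂ[X][X] := C (C B.leadingCoeff⁻¹) * (B.map C - C B) with hfB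
  set fD : ℂ[X][X] := C (C D.leadingCoeff⁻¹) * (D.map C - C D) with hfD
  have hfB' : fB.map ψ = _ := map_C_mul_map_sub hx rfl hB
  have hfD' : fD.map ψ = _ := map_C_mul_map_sub hx rfl hD
  have hmonB : fB.Monic := monic_C_mul_map_sub hB0
  obtain ⟨q, hqmon, hMdvd, hqroot⟩ := exists_monic_dvd_of_common_roots ψ hψi hmonB fD
  rw [hfB'] at hMdvd
  have hMmon : (q.map ψ).Monic := hqmon.map ψ
  have hroot : ∀ y, (q.map ψ).eval y = 0 ↔ ∃ ξ : ℂˣ, ξ ^ g = 1 ∧ y = rot ξ x := by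
    intro y
    rw [hqroot, hfB', hfD', isRoot_prod_iff, isRoot_prod_iff]
    constructor
    · rintro ⟨⟨ξ, h, rfl⟩, η, h', e⟩
      obtain rfl := rot_injective hx e
      exact ⟨ξ, pow_gcd_eq_one.mpr ⟨h, h'⟩, rfl⟩
    · rintro ⟨ξ, h, rfl⟩
      obtain ⟨i, hi⟩ := Nat.gcd_dvd_left B.natDegree D.natDegree
      obtain ⟨j, hj⟩ := Nat.gcd_dvd_right B.natDegree D.natDegree
      exact ⟨⟨ξ, by rw [hi, pow_mul, ← hg, h, one_pow], rfl⟩,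
        ξ, by rw [hj, pow_mul, ← hg, h, one_pow], rfl⟩
  have hsplit : (q.map ψ).Splits :=
    Splits.of_dvd (Splits.prod fun _ _ => Splits.X_sub_C _)
      (Finset.prod_ne_zero_iff.mpr fun _ _ => X_sub_C_ne_zero _) hMdvd
  have hnodup : (q.map ψ).roots.Nodup :=
    nodup_roots ((separable_prod_X_sub_C_iff.mpr (rot_subtype_injective hx _)).of_dvd hMdvd)
  have hcard : (q.map ψ).natDegree ≤ g := by
    rw [hsplit.natDegree_eq_card_roots, ← Multiset.toFinset_card_of_nodup hnodup]
    calc _ ≤ (Finset.univ.image fun ξ : rootsOfUnity g ℂ => rot (ξ : ℂˣ) x).card := by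
          refine Finset.card_le_card fun y hy => ?_
          rw [Multiset.mem_toFinset, mem_roots hMmon.ne_zero, IsRoot.def, hroot] at hy
          obtain ⟨ξ, h, rfl⟩ := hy
          exact Finset.mem_image.mpr ⟨⟨ξ, (mem_rootsOfUnity _ _).mpr h⟩, Finset.mem_univ _, rfl⟩
      _ ≤ _ := Finset.card_image_le.trans (by simp [card_rootsOfUnity])
  have hM : q.map ψ = ∏ ξ : rootsOfUnity g ℂ, (X - C (rot (ξ : ℂˣ) x)) := by
    have := eq_leadingCoeff_mul_of_monic_of_dvd_of_natDegree_le
      (p := ∏ ξ : rootsOfUnity g ℂ, (X - C (rot (ξ : ℂˣ) x))) (q := q.map ψ)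
      (monic_prod_of_monic _ _ fun _ _ => monic_X_sub_C _) ?_ ?_
    · rwa [hMmon.leadingCoeff, map_one, one_mul] at this
    · refine Finset.prod_dvd_of_coprime
        (fun ξ _ η _ h => pairwise_coprime_X_sub_C (rot_subtype_injective hx g) h) ?_
      intro ξ _
      rw [dvd_iff_isRoot, IsRoot.def, hroot]
      exact ⟨ξ, (mem_rootsOfUnity _ _).mp ξ.2, rfl⟩
    · rw [natDegree_prod_of_monic _ _ fun _ _ => monic_X_sub_C _]
      simpa [card_rootsOfUnity] using hcard
  have hG : (q.coeff 0).eval₂ const x = ∏ ξ : rootsOfUnity g ℂ, rot (ξ : ℂˣ) (-x) := by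
    have := congrArg (fun p => p.coeff 0) hM
    simp only [coeff_map, coeff_zero_prod] at this
    simpa [hψ] using this
  refine ⟨q.coeff 0, fun η hη => ?_, natDegree_eq_of_hasPole hx ?_⟩
  · rw [hG, rot_prod_rot _ hη]
  · rw [hG]
    simpa [card_rootsOfUnity] using HasPole.prod Finset.univ
      (fun ξ : rootsOfUnity g ℂ => rot (ξ : ℂˣ) (-x)) fun ξ _ => hx.neg.rot ξ

end Point

/-- A subalgebra of `ℂ[X]` all of whose degrees are multiples of the degree of one of its elements
`G` consists of polynomials in `G`. -/
lemma exists_comp_of_mem {S : Subalgebra ℂ ℂ[X]} {G : ℂ[X]} (hG : G ∈ S) (hG0 : G.natDegree ≠ 0)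
    (hS : ∀ P ∈ S, G.natDegree ∣ P.natDegree) {P : ℂ[X]} (hP : P ∈ S) :
    ∃ E : ℂ[X], P = E.comp G := by
  induction hn : P.natDegree using Nat.strong_induction_on generalizing P with
  | _ n ih =>
  by_cases hn0 : n = 0
  · obtain ⟨c, rfl⟩ := natDegree_eq_zero.mp (hn.trans hn0)
    exact ⟨C c, by simp⟩
  obtain ⟨k, hk⟩ := hS P hP
  have hGne : G ≠ 0 := by rintro rfl; simp at hG0
  have hPne : P ≠ 0 := by rintro rfl; simp at hn; omega
  have hlc : P.leadingCoeff / G.leadingCoeff ^ k ≠ 0 := by simp [hGne, hPne]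
  have hd : (C (P.leadingCoeff / G.leadingCoeff ^ k) * G ^ k).natDegree = P.natDegree := by
    rw [natDegree_C_mul hlc, natDegree_pow, hk, mul_comm]
  have hlt : (P - C (P.leadingCoeff / G.leadingCoeff ^ k) * G ^ k).natDegree < n := by
    rw [← hn]
    set T := C (P.leadingCoeff / G.leadingCoeff ^ k) * G ^ k with hT
    have hTne : T ≠ 0 := mul_ne_zero (C_ne_zero.mpr hlc) (pow_ne_zero k hGne)
    by_cases hPT : P - T = 0
    · rw [hPT, natDegree_zero]
      omega
    refine natDegree_lt_natDegree hPT (degree_sub_lt_left ?_ hPne ?_)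
    · rw [degree_eq_natDegree hPne, degree_eq_natDegree hTne, hd]
    · rw [hT, leadingCoeff_mul, leadingCoeff_C, leadingCoeff_pow, div_mul_cancel₀]
      simpa using fun h => absurd h hGne
  have hmem : P - C (P.leadingCoeff / G.leadingCoeff ^ k) * G ^ k ∈ S :=
    S.sub_mem hP (S.mul_mem (S.algebraMap_mem _) (S.pow_mem hG k))
  obtain ⟨E, hE⟩ := ih _ hlt hmem rfl
  refine ⟨E + C (P.leadingCoeff / G.leadingCoeff ^ k) * X ^ k, ?_⟩
  rw [add_comp, ← hE, mul_comp, C_comp, X_pow_comp]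
  ring

lemma natDegree_ne_zero_of_comp {A B : ℂ[X]} (h : (A.comp B).natDegree ≠ 0) :
    A.natDegree ≠ 0 ∧ B.natDegree ≠ 0 := by
  rw [natDegree_comp] at h
  exact ⟨left_ne_zero_of_mul h, right_ne_zero_of_mul h⟩

/-- Two right factors `B`, `D` of a polynomial have a common right factor of degree
`gcd (deg B) (deg D)`. -/
lemma exists_right_gcd {A B C' D : ℂ[X]} (h : A.comp B = C'.comp D)
    (h0 : (A.comp B).natDegree ≠ 0) :
    ∃ G E₁ E₂ : ℂ[X], B = E₁.comp G ∧ D = E₂.comp G ∧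
      G.natDegree = B.natDegree.gcd D.natDegree := by
  obtain ⟨hA0, hB0⟩ := natDegree_ne_zero_of_comp h0
  obtain ⟨hC0, hD0⟩ := natDegree_ne_zero_of_comp (h ▸ h0)
  obtain ⟨x, hx, hF⟩ := exists_point h0
  have hF := mem_invariants_of_eval₂_mul hF
  have hB := right_factor_mem_invariants hx hF rfl hA0 hB0
  have hD := right_factor_mem_invariants hx hF h hC0 hD0
  obtain ⟨G, hG, hGd⟩ := exists_invariant_gcd hx hB hD hB0 hD0
  have hg0 : B.natDegree.gcd D.natDegree ≠ 0 := by simp [hB0]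
  have hS : ∀ P ∈ invariants x (B.natDegree.gcd D.natDegree), G.natDegree ∣ P.natDegree :=
    fun P hP => hGd ▸ dvd_natDegree_of_mem_invariants hx hg0 hP
  obtain ⟨E₁, h₁⟩ := exists_comp_of_mem hG (hGd ▸ hg0) hS
    (invariants_mono x (Nat.gcd_dvd_left _ _) hB)
  obtain ⟨E₂, h₂⟩ := exists_comp_of_mem hG (hGd ▸ hg0) hS
    (invariants_mono x (Nat.gcd_dvd_right _ _) hD)
  exact ⟨G, E₁, E₂, h₁, h₂, hGd⟩

/-- Two right factors `B`, `D` of coprime degrees of a polynomial have a common left multiple of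
degree `deg B * deg D` which is again a right factor. -/
lemma exists_right_lcm {A B C' D : ℂ[X]} (h : A.comp B = C'.comp D)
    (h0 : (A.comp B).natDegree ≠ 0) (hBD : B.natDegree.Coprime D.natDegree) :
    ∃ E U V : ℂ[X], U.comp B = V.comp D ∧ A.comp B = E.comp (U.comp B) ∧
      U.natDegree = D.natDegree ∧ V.natDegree = B.natDegree := by
  obtain ⟨hA0, hB0⟩ := natDegree_ne_zero_of_comp h0
  obtain ⟨hC0, hD0⟩ := natDegree_ne_zero_of_comp (h ▸ h0)
  obtain ⟨x, hx, hF⟩ := exists_point h0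
  have hF := mem_invariants_of_eval₂_mul hF
  have hB := right_factor_mem_invariants hx hF rfl hA0 hB0
  have hD := right_factor_mem_invariants hx hF h hC0 hD0
  obtain ⟨H, hHB, hHD, hHd⟩ := exists_invariant_lcm hx hB hD hB0 hD0
  obtain ⟨U, hU⟩ := exists_comp_of_mem hB hB0
    (fun P hP => dvd_natDegree_of_mem_invariants hx hB0 hP) hHB
  obtain ⟨V, hV⟩ := exists_comp_of_mem hD hD0
    (fun P hP => dvd_natDegree_of_mem_invariants hx hD0 hP) hHD
  obtain ⟨E, hE⟩ := exists_comp_of_mem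
    (S := invariants x B.natDegree ⊓ invariants x D.natDegree) ⟨hHB, hHD⟩
    (by rw [hHd]; exact mul_ne_zero hB0 hD0)
    (fun P hP => hHd ▸ hBD.mul_dvd_of_dvd_of_dvd (dvd_natDegree_of_mem_invariants hx hB0 hP.1)
      (dvd_natDegree_of_mem_invariants hx hD0 hP.2))
    (P := A.comp B)
    ⟨invariants_mono x (by rw [natDegree_comp]; exact dvd_mul_left _ _) hF,
      invariants_mono x (by rw [h, natDegree_comp]; exact dvd_mul_left _ _) hF⟩
  refine ⟨E, U, V, hU ▸ hV, by rw [← hU]; exact hE, ?_, ?_⟩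
  · rw [hU, natDegree_comp, mul_comm] at hHd
    exact mul_left_cancel₀ hB0 hHd
  · rw [hV, natDegree_comp] at hHd
    exact mul_right_cancel₀ hD0 hHd

lemma comp_right_cancel {A C' B : ℂ[X]} (hB : B.natDegree ≠ 0) (h : A.comp B = C'.comp B) :
    A = C' := by
  have : (A - C').comp B = 0 := by rw [sub_comp, h, sub_self]
  rcases comp_eq_zero_iff.mp this with h' | ⟨-, h'⟩
  · exact sub_eq_zero.mp h'
  · rw [h', natDegree_C] at hB
    exact absurd rfl hB

/-- A linear polynomial has an inverse for composition. -/
lemma exists_comp_inverse {l : ℂ[X]} (hl : l.natDegree = 1) :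
    ∃ m : ℂ[X], m.natDegree = 1 ∧ m.comp l = X ∧ l.comp m = X := by
  obtain ⟨a, ha, b, rfl⟩ := natDegree_eq_one.mp hl
  refine ⟨C a⁻¹ * X - C (a⁻¹ * b), ?_, ?_, ?_⟩
  · rw [natDegree_sub_C, natDegree_C_mul_X _ (inv_ne_zero ha)]
  · simp only [sub_comp, mul_comp, C_comp, X_comp, C_mul, mul_add]
    rw [← mul_assoc, ← C_mul, inv_mul_cancel₀ ha]
    simp
  · simp only [add_comp, mul_comp, C_comp, X_comp, mul_sub]
    rw [← mul_assoc, ← C_mul, ← C_mul, ← mul_assoc, mul_inv_cancel₀ ha]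
    simp

lemma indecomposable_linear_comp {l P : ℂ[X]} (hl : l.natDegree = 1) (hP : Indecomposable P) :
    Indecomposable (l.comp P) := by
  obtain ⟨m, hm, hml, -⟩ := exists_comp_inverse hl
  refine ⟨by rw [natDegree_comp, hl, one_mul]; exact hP.1, ?_⟩
  rintro ⟨Q, R, hQ, hR, h⟩
  refine hP.2 ⟨m.comp Q, R, by rwa [natDegree_comp, hm, one_mul], hR, ?_⟩
  rw [comp_assoc, ← h, ← comp_assoc, hml, X_comp]

lemma indecomposable_comp_linear {l P : ℂ[X]} (hl : l.natDegree = 1) (hP : Indecomposable P) :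
    Indecomposable (P.comp l) := by
  obtain ⟨m, hm, -, hlm⟩ := exists_comp_inverse hl
  refine ⟨by rw [natDegree_comp, hl, mul_one]; exact hP.1, ?_⟩
  rintro ⟨Q, R, hQ, hR, h⟩
  refine hP.2 ⟨Q, R.comp m, hQ, by rwa [natDegree_comp, hm, mul_one], ?_⟩
  rw [← comp_assoc, ← h, comp_assoc, hlm, comp_X]

lemma foldr_comp (L : List ℂ[X]) (P : ℂ[X]) :
    L.foldr Polynomial.comp P = (L.foldr Polynomial.comp X).comp P := by
  induction L with
  | nil => simp
  | cons Q L ih => rw [List.foldr_cons, List.foldr_cons, ih, comp_assoc]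

lemma foldr_append_singleton (L : List ℂ[X]) (P : ℂ[X]) :
    (L ++ [P]).foldr Polynomial.comp X = (L.foldr Polynomial.comp X).comp P := by
  rw [List.foldr_append, List.foldr_cons, List.foldr_nil, comp_X, foldr_comp]

lemma natDegree_foldr_pos {L : List ℂ[X]} (hL : ∀ P ∈ L, Indecomposable P) :
    (L.foldr Polynomial.comp X).natDegree ≠ 0 := by
  induction L with
  | nil => simp
  | cons Q L ih =>
    rw [List.foldr_cons, natDegree_comp]
    have := (hL Q (by simp)).1
    exact mul_ne_zero (by omega) (ih fun P hP => hL P (by simp [hP]))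

lemma eq_nil_of_natDegree_foldr {L : List ℂ[X]} (hL : ∀ P ∈ L, Indecomposable P)
    (h : (L.foldr Polynomial.comp X).natDegree = 1) : L = [] := by
  cases L with
  | nil => rfl
  | cons Q L =>
    rw [List.foldr_cons, natDegree_comp] at h
    have := (hL Q (by simp)).1
    have := Nat.eq_one_of_mul_eq_one_right h
    omega

/-- Every nonconstant polynomial is a composition of indecomposable polynomials and a linear
polynomial. -/
lemma exists_decomposition (P : ℂ[X]) (hP : P.natDegree ≠ 0) :
    ∃ (L : List ℂ[X]) (l : ℂ[X]), (∀ Q ∈ L, Indecomposable Q) ∧ l.natDegree = 1 ∧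
      P = (L.foldr Polynomial.comp X).comp l := by
  induction hn : P.natDegree using Nat.strong_induction_on generalizing P with
  | _ n ih =>
  by_cases h1 : P.natDegree = 1
  · exact ⟨[], P, by simp, h1, by simp⟩
  by_cases hind : Indecomposable P
  · exact ⟨[P], X, by simpa using hind, natDegree_X, by simp⟩
  have h2 : 2 ≤ P.natDegree := by omega
  obtain ⟨Q, R, hQ, hR, rfl⟩ : ∃ Q R : ℂ[X], 2 ≤ Q.natDegree ∧ 2 ≤ R.natDegree ∧ P = Q.comp R := by
    by_contra hne
    exact hind ⟨h2, hne⟩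
  rw [natDegree_comp] at hn
  obtain ⟨L₂, l₂, hL₂, hl₂, hR'⟩ := ih _ (by nlinarith) R (by omega) rfl
  obtain ⟨L₁, l₁, hL₁, hl₁, hQ'⟩ := ih _ (by nlinarith) Q (by omega) rfl
  cases L₂ with
  | nil =>
    rw [List.foldr_nil, X_comp] at hR'
    rw [hR', hl₂] at hR
    omega
  | cons S L =>
    refine ⟨L₁ ++ l₁.comp S :: L, l₂, ?_, hl₂, ?_⟩
    · intro T hT
      rcases List.mem_append.mp hT with hT | hT
      · exact hL₁ T hT
      · rcases List.mem_cons.mp hT with rfl | hT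
        · exact indecomposable_linear_comp hl₁ (hL₂ S (by simp))
        · exact hL₂ T (by simp [hT])
    · rw [List.foldr_append, foldr_comp L₁]
      nth_rw 1 [hQ', hR']
      simp only [List.foldr_cons, comp_assoc]

lemma eq_nil_or_eq_append_singleton {L : List ℂ[X]} (hL : ∀ P ∈ L, Indecomposable P) :
    L = [] ∨ ∃ L' B, L = L' ++ [B] ∧ (∀ P ∈ L', Indecomposable P) ∧ Indecomposable B := by
  rcases List.eq_nil_or_concat L with h | ⟨L', B, rfl⟩
  · exact Or.inl h
  · refine Or.inr ⟨L', B, by simp, fun P hP => hL P (by simp [hP]), hL B (by simp)⟩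

/-- The middle factor of the exchange step is indecomposable. -/
lemma indecomposable_of_comp_eq_comp {U B V D : ℂ[X]} (h : U.comp B = V.comp D)
    (hB : B.natDegree ≠ 0) (hD : Indecomposable D) (hU : U.natDegree = D.natDegree)
    (hBD : B.natDegree.Coprime D.natDegree) : Indecomposable U := by
  refine ⟨hU ▸ hD.1, ?_⟩
  rintro ⟨Q, R, hQ, hR, rfl⟩
  rw [natDegree_comp] at hU
  have h' : Q.comp (R.comp B) = V.comp D := by rw [← comp_assoc, h]
  obtain ⟨G, E₁, E₂, -, h₂, hG⟩ := exists_right_gcd h' (by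
    simp only [natDegree_comp]
    exact mul_ne_zero (by omega) (mul_ne_zero (by omega) hB))
  have hg : (R.comp B).natDegree.gcd D.natDegree = R.natDegree := by
    rw [natDegree_comp, ← hU, mul_comm Q.natDegree, Nat.gcd_mul_left]
    rw [← hU] at hBD
    rw [(Nat.Coprime.coprime_mul_right_right hBD : Nat.gcd _ _ = 1), mul_one]
  rw [hg] at hG
  refine hD.2 ⟨E₂, G, ?_, hG ▸ hR, h₂⟩
  have := congrArg natDegree h₂
  rw [natDegree_comp, hG, ← hU] at this
  rwa [← mul_right_cancel₀ (by omega) this]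

/-- Right factors that are indecomposable either differ by a linear polynomial or have coprime
degrees. -/
lemma linear_or_coprime {A B C' D : ℂ[X]} (h : A.comp B = C'.comp D)
    (h0 : (A.comp B).natDegree ≠ 0) (hB : Indecomposable B) (hD : Indecomposable D) :
    (∃ m : ℂ[X], m.natDegree = 1 ∧ D = m.comp B) ∨ B.natDegree.Coprime D.natDegree := by
  obtain ⟨G, E₁, E₂, h₁, h₂, hG⟩ := exists_right_gcd h h0
  by_cases hg : G.natDegree = 1
  · exact Or.inr (hG.symm.trans hg)
  left
  have key : ∀ {P E : ℂ[X]}, Indecomposable P → P = E.comp G → E.natDegree = 1 := by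
    intro P E hP hPE
    have hd := congrArg natDegree hPE
    have h2 := hP.1
    rw [hd] at h2
    obtain ⟨hE0, hG0⟩ := natDegree_ne_zero_of_comp (A := E) (B := G) (by omega)
    by_contra hE
    exact hP.2 ⟨E, G, by omega, by omega, hPE⟩
  obtain ⟨m, hm, hmE, -⟩ := exists_comp_inverse (key hB h₁)
  refine ⟨E₂.comp m, by rw [natDegree_comp, key hD h₂, hm], ?_⟩
  rw [h₁, comp_assoc, ← comp_assoc m, hmE, X_comp, h₂]

lemma length_eq_of_foldr_eq_comp (L₁ L₂ : List ℂ[X]) (l : ℂ[X])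
    (h₁ : ∀ P ∈ L₁, Indecomposable P) (h₂ : ∀ P ∈ L₂, Indecomposable P) (hl : l.natDegree = 1)
    (heq : L₁.foldr Polynomial.comp X = (L₂.foldr Polynomial.comp X).comp l) :
    L₁.length = L₂.length := by
  induction hn : (L₁.foldr Polynomial.comp X).natDegree using Nat.strong_induction_on
    generalizing L₁ L₂ l with
  | _ n ih =>
  have hdeg := congrArg natDegree heq
  rw [natDegree_comp, hl, mul_one] at hdeg
  rcases eq_nil_or_eq_append_singleton h₁ with rfl | ⟨M₁, B, rfl, hM₁, hB⟩
  · rw [List.foldr_nil, natDegree_X] at hdeg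
    rw [eq_nil_of_natDegree_foldr h₂ hdeg.symm]
  rcases eq_nil_or_eq_append_singleton h₂ with rfl | ⟨M₂, D, rfl, hM₂, hD⟩
  · rw [List.foldr_nil, natDegree_X] at hdeg
    rw [eq_nil_of_natDegree_foldr h₁ hdeg]
  have h0 := natDegree_foldr_pos h₁
  rw [foldr_append_singleton] at h0 hn
  rw [foldr_append_singleton, foldr_append_singleton, comp_assoc] at heq
  have hDl := indecomposable_comp_linear hl hD
  have hB2 := hB.1
  have hA0 := (natDegree_ne_zero_of_comp h0).1
  have hlt : (M₁.foldr Polynomial.comp X).natDegree < n := by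
    rw [← hn, natDegree_comp]
    nlinarith [Nat.pos_of_ne_zero hA0]
  simp only [List.length_append, List.length_singleton, add_left_inj]
  rcases linear_or_coprime heq h0 hB hDl with ⟨m, hm, hDm⟩ | hcop
  · rw [hDm, ← comp_assoc] at heq
    exact ih _ hlt M₁ M₂ m hM₁ hM₂ hm (comp_right_cancel (by omega) heq) rfl
  obtain ⟨E, U, V, hUV, hE, hU, hV⟩ := exists_right_lcm heq h0 hcop
  have hDl2 := hDl.1
  have hUi := indecomposable_of_comp_eq_comp hUV (by omega) hDl hU hcop
  have hVi := indecomposable_of_comp_eq_comp hUV.symm (by omega) hB hV hcop.symm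
  obtain ⟨N, e, hN, he, rfl⟩ := exists_decomposition E
    (natDegree_ne_zero_of_comp (hE ▸ h0)).1
  have hmem : ∀ {W : ℂ[X]}, Indecomposable W → ∀ P ∈ N ++ [e.comp W], Indecomposable P := by
    intro W hW P hP
    rcases List.mem_append.mp hP with hP | hP
    · exact hN P hP
    · rw [List.mem_singleton.mp hP]
      exact indecomposable_linear_comp he hW
  have hfold : ∀ W : ℂ[X], (N ++ [e.comp W]).foldr Polynomial.comp X =
      ((N.foldr Polynomial.comp X).comp e).comp W := fun W => by
    rw [foldr_append_singleton, comp_assoc]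
  have e₁ : M₁.foldr Polynomial.comp X = ((N ++ [e.comp U]).foldr Polynomial.comp X).comp X := by
    rw [comp_X, hfold]
    exact comp_right_cancel (by omega) (hE.trans (comp_assoc _ _ _).symm)
  have e₂ : M₂.foldr Polynomial.comp X = ((N ++ [e.comp V]).foldr Polynomial.comp X).comp X := by
    rw [comp_X, hfold]
    exact comp_right_cancel (B := D.comp l) (by omega)
      ((heq.symm.trans hE).trans (hUV ▸ (comp_assoc _ V _).symm))
  have hlt₂ : (M₂.foldr Polynomial.comp X).natDegree < n := by
    rw [← hn, heq, natDegree_comp]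
    nlinarith [Nat.pos_of_ne_zero (natDegree_foldr_pos hM₂)]
  have r₁ := ih _ hlt M₁ _ X hM₁ (hmem hUi) natDegree_X e₁ rfl
  have r₂ := ih _ hlt₂ M₂ _ X hM₂ (hmem hVi) natDegree_X e₂ rfl
  simp only [List.length_append, List.length_singleton] at r₁ r₂
  omega

end Ritt

/-- Theorem 5.6 (J. F. Ritt, 1922), equal-length part: any two complete
decompositions of a polynomial into indecomposable factors have the same
number of factors. -/
theorem ritt_decompositions_same_length (L₁ L₂ : List ℂ[X])
    (h₁ : ∀ P ∈ L₁, Indecomposable P) (h₂ : ∀ P ∈ L₂, Indecomposable P)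
    (heq : L₁.foldr Polynomial.comp X = L₂.foldr Polynomial.comp X) :
    L₁.length = L₂.length :=
  Ritt.length_eq_of_foldr_eq_comp L₁ L₂ X h₁ h₂ natDegree_X (by rw [comp_X, heq])
end

section
/- Let K be a field of characteristic 0 and let P ∈ K[X]. Suppose P = Q₁ ∘ R₁ = Q₂ ∘ R₂ where deg Q₁ = deg Q₂ = q ≥ 2, deg R₁ = deg R₂ = r ≥ 2, and both R₁ and R₂ are monic with constant coefficient 0. Then Q₁ = Q₂ and R₁ = R₂. -/
open Polynomial

/-- For monic `R`, `S` of degree `r`, the coefficient of `∑ R ^ i * S ^ (n - 1 - i)` in degree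
`(n - 1) * r` is `n`. -/
theorem Polynomial.coeff_geom_sum₂_of_monic {A : Type*} [CommSemiring A] [Nontrivial A]
    {R S : A[X]} {r : ℕ} (hR : R.Monic) (hS : S.Monic) (hRr : R.natDegree = r)
    (hSr : S.natDegree = r) (n : ℕ) :
    (∑ i ∈ Finset.range n, R ^ i * S ^ (n - 1 - i)).coeff ((n - 1) * r) = n := by
  rw [finsetSum_coeff, Finset.sum_congr rfl (g := fun _ => (1 : A)), Finset.sum_const,
    Finset.card_range, nsmul_one]
  intro i hi
  have hdeg : (R ^ i * S ^ (n - 1 - i)).natDegree = (n - 1) * r := by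
    rw [(hR.pow i).natDegree_mul (hS.pow _), hR.natDegree_pow, hS.natDegree_pow, hRr, hSr,
      ← add_mul]
    congr 1
    have := Finset.mem_range.mp hi
    omega
  rw [← hdeg]
  exact ((hR.pow i).mul (hS.pow _)).coeff_natDegree

/-- Composing with a nonconstant polynomial on the right is injective. -/
theorem Polynomial.eq_of_comp_eq_comp {A : Type*} [CommRing A] [IsDomain A] {P Q R : A[X]}
    (hR : R.natDegree ≠ 0) (h : P.comp R = Q.comp R) : P = Q := by
  rcases comp_eq_zero_iff.mp (show (P - Q).comp R = 0 by rw [sub_comp, h, sub_self]) with h | h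
  · exact sub_eq_zero.mp h
  · exact absurd (by rw [h.2, natDegree_C]) hR

/-- Theorem 3.3(a), uniqueness part: a polynomial has at most one normal
`(q,r)` decomposition `P = Q ∘ R` with `R` monic and with constant
coefficient `0`. -/
theorem normal_decomposition_unique {K : Type*} [Field K] [CharZero K]
    (P Q₁ R₁ Q₂ R₂ : K[X]) (q r : ℕ) (hq : 2 ≤ q) (hr : 2 ≤ r)
    (hQ₁ : Q₁.natDegree = q) (hQ₂ : Q₂.natDegree = q)
    (hR₁ : R₁.natDegree = r) (hR₂ : R₂.natDegree = r)
    (hR₁m : R₁.Monic) (hR₁0 : R₁.coeff 0 = 0)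
    (hR₂m : R₂.Monic) (hR₂0 : R₂.coeff 0 = 0)
    (h₁ : P = Q₁.comp R₁) (h₂ : P = Q₂.comp R₂) :
    Q₁ = Q₂ ∧ R₁ = R₂ := by
  have hlead : Q₂.leadingCoeff = Q₁.leadingCoeff := by
    have h := congrArg leadingCoeff (h₁.symm.trans h₂)
    rw [leadingCoeff_comp (by omega), leadingCoeff_comp (by omega), hR₁m.leadingCoeff,
      hR₂m.leadingCoeff] at h
    simpa using h.symm
  have hQ₁0 : Q₁.leadingCoeff ≠ 0 := by
    rw [leadingCoeff_ne_zero]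
    rintro rfl
    simp at hQ₁
    omega
  have expand : ∀ Q R : K[X],
      Q.comp R = Q.eraseLead.comp R + C Q.leadingCoeff * R ^ Q.natDegree := by
    intro Q R
    conv_lhs => rw [← Q.eraseLead_add_C_mul_X_pow]
    rw [add_comp, mul_comp, C_comp, X_pow_comp]
  have lower : ∀ Q R : K[X], Q.natDegree = q → R.natDegree = r →
      (Q.eraseLead.comp R).natDegree ≤ (q - 1) * r := by
    intro Q R hQ hR
    rw [natDegree_comp, hR, ← hQ]
    exact Nat.mul_le_mul_right r Q.eraseLead_natDegree_le
  set G : K[X] := ∑ i ∈ Finset.range q, R₁ ^ i * R₂ ^ (q - 1 - i) with hG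
  have hGcoeff : G.coeff ((q - 1) * r) ≠ 0 := by
    rw [hG, coeff_geom_sum₂_of_monic hR₁m hR₂m hR₁ hR₂, Nat.cast_ne_zero]
    omega
  have key : C Q₁.leadingCoeff * (G * (R₁ - R₂)) =
      Q₂.eraseLead.comp R₂ - Q₁.eraseLead.comp R₁ := by
    have h := h₁.symm.trans h₂
    rw [expand Q₁, expand Q₂, hlead, hQ₁, hQ₂] at h
    rw [hG, (Commute.all R₁ R₂).geom_sum₂_mul]
    linear_combination h
  have hR : R₁ = R₂ := by
    by_contra hne
    have hsub : R₁ - R₂ ≠ 0 := sub_ne_zero.mpr hne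
    have hG0 : G ≠ 0 := by
      intro h
      simp [h] at hGcoeff
    have hle := natDegree_sub_le_of_le (lower Q₂ R₂ hQ₂ hR₂) (lower Q₁ R₁ hQ₁ hR₁)
    rw [← key, natDegree_C_mul hQ₁0, natDegree_mul hG0 hsub, max_self] at hle
    have hGdeg := le_natDegree_of_ne_zero hGcoeff
    have hconst := eq_C_of_natDegree_eq_zero (show (R₁ - R₂).natDegree = 0 by omega)
    rw [coeff_sub, hR₁0, hR₂0, sub_zero, C_0] at hconst
    exact hsub hconst
  subst hR
  exact ⟨eq_of_comp_eq_comp (by omega) (h₁.symm.trans h₂), rfl⟩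
end

section
/- Let K ⊆ L be fields of characteristic 0 and let P ∈ K[X]. Suppose that the image of P in L[X] has a (q,r) decomposition: there exist Q, R ∈ L[X] with deg Q = q ≥ 2, deg R = r ≥ 2 and (image of P) = Q ∘ R. Then there exist Q₀, R₀ ∈ K[X] with deg Q₀ = q, deg R₀ = r, R₀ monic with constant coefficient 0, and P = Q₀ ∘ R₀. -/
open Polynomial

/-- The top coefficient of `A ^ q - B ^ q` for monic `A`, `B` of degree `r`. -/
theorem Polynomial.coeff_pow_sub_pow_of_monic {L : Type*} [CommRing L] {A B : L[X]}
    {r : ℕ} (hA : A.Monic) (hB : B.Monic) (hAr : A.natDegree = r) (hBr : B.natDegree = r) (q : ℕ) :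
    (A ^ q - B ^ q).coeff ((q - 1) * r + (A - B).natDegree) = q * (A - B).leadingCoeff := by
  have hmonic (i : ℕ) : (A ^ i * B ^ (q - 1 - i)).Monic := (hA.pow _).mul (hB.pow _)
  have hdeg : ∀ i ∈ Finset.range q, (A ^ i * B ^ (q - 1 - i)).natDegree = (q - 1) * r := by
    intro i hi
    rw [(hA.pow _).natDegree_mul (hB.pow _), hA.natDegree_pow, hB.natDegree_pow, hAr, hBr,
      ← add_mul, Nat.add_sub_cancel' (Nat.le_sub_one_of_lt (Finset.mem_range.1 hi))]
  rw [← (Commute.all A B).geom_sum₂_mul,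
    coeff_mul_add_eq_of_natDegree_le (natDegree_sum_le_of_forall_le _ _ fun i hi => (hdeg i hi).le) le_rfl,
    finsetSum_coeff, Finset.sum_congr rfl fun i hi => by
      rw [← hdeg i hi, (hmonic i).coeff_natDegree]]
  simp

/-- If the coefficients of `R ^ q` above degree `(q - 1) * deg R` lie in the base field, then so do
all coefficients of the monic polynomial `R`, except possibly the constant one. -/
theorem Polynomial.exists_monic_map_add_C_of_coeff_pow_mem {K L : Type*} [Field K] [Field L]
    [CharZero L] (f : K →+* L) {R : L[X]} (hR : R.Monic) {q : ℕ} (hq : q ≠ 0)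
    (h : ∀ n, (q - 1) * R.natDegree < n → (R ^ q).coeff n ∈ f.fieldRange) :
    ∃ A : K[X], A.Monic ∧ A.natDegree = R.natDegree ∧ ∃ c, R = A.map f + C c := by
  suffices key : ∀ d, ∀ A : K[X], A.Monic → A.natDegree = R.natDegree →
      (R - A.map f).natDegree = d →
      ∃ A : K[X], A.Monic ∧ A.natDegree = R.natDegree ∧ ∃ c, R = A.map f + C c from
    key _ (X ^ R.natDegree) (monic_X_pow _) (natDegree_X_pow _) rfl
  intro d
  induction d using Nat.strong_induction_on with
  | _ d ih =>
  intro A hA hAR hd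
  rcases Nat.eq_zero_or_pos d with rfl | hpos
  · exact ⟨A, hA, hAR, _, eq_add_of_sub_eq' (eq_C_of_natDegree_eq_zero hd)⟩
  have hAf : (A.map f).natDegree = R.natDegree := by rw [natDegree_map, hAR]
  obtain ⟨a, ha⟩ : (R - A.map f).leadingCoeff ∈ f.fieldRange := by
    have hcoeff := coeff_pow_sub_pow_of_monic hR (hA.map f) rfl hAf q
    rw [← mul_right_inj' (inv_ne_zero (Nat.cast_ne_zero (R := L).2 hq)),
      inv_mul_cancel_left₀ (Nat.cast_ne_zero.2 hq)] at hcoeff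
    rw [← hcoeff, coeff_sub, ← Polynomial.map_pow, coeff_map]
    exact mul_mem (inv_mem (natCast_mem _ q)) (sub_mem (h _ (by lia)) ⟨_, rfl⟩)
  have hlt : (R - A.map f).natDegree < R.natDegree := by
    refine natDegree_lt_natDegree (fun h0 => by simp [h0] at hd; lia) (degree_sub_lt_left ?_ hR.ne_zero ?_)
    · rw [degree_eq_natDegree hR.ne_zero, degree_eq_natDegree (hA.map f).ne_zero, hAf]
    · rw [hR.leadingCoeff, (hA.map f).leadingCoeff]
  have hmon : (monomial d a).degree < A.degree :=
    (degree_monomial_le _ _).trans_lt <| by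
      rw [degree_eq_natDegree hA.ne_zero, hAR]
      exact_mod_cast hd ▸ hlt
  have herase : R - (A + monomial d a).map f = (R - A.map f).eraseLead := by
    rw [← self_sub_monomial_natDegree_leadingCoeff, hd, ← ha, Polynomial.map_add, map_monomial,
      sub_sub]
  refine ih _ ?_ (A + monomial d a) (hA.add_of_left hmon) ?_ rfl
  · rw [herase]
    exact (eraseLead_natDegree_le _).trans_lt (by lia)
  · rw [natDegree_add_eq_left_of_degree_lt hmon, hAR]

/-- If `Q ∘ A` and the monic polynomial `A` are defined over the base field, then so is `Q`. -/
theorem Polynomial.exists_map_eq_of_map_eq_comp {K L : Type*} [Field K] [Field L] (f : K →+* L)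
    {A : K[X]} (hA : A.Monic) (hA0 : A.natDegree ≠ 0) {P : K[X]} {Q : L[X]}
    (h : P.map f = Q.comp (A.map f)) : ∃ Q₀ : K[X], Q₀.map f = Q := by
  induction hn : Q.natDegree using Nat.strong_induction_on generalizing P Q with
  | _ n ih =>
  rcases Nat.eq_zero_or_pos n with rfl | hpos
  · obtain ⟨a, rfl⟩ := natDegree_eq_zero.1 hn
    exact ⟨P, by rw [h, C_comp]⟩
  have hlead : f P.leadingCoeff = Q.leadingCoeff := by
    rw [← leadingCoeff_map, h, leadingCoeff_comp (by rwa [natDegree_map]),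
      (hA.map f).leadingCoeff, one_pow, mul_one]
  obtain ⟨Q₁, hQ₁⟩ := ih _ ((eraseLead_natDegree_le Q).trans_lt (by lia))
    (P := P - C P.leadingCoeff * A ^ Q.natDegree) (Q := Q.eraseLead) (by
      rw [← self_sub_monomial_natDegree_leadingCoeff, sub_comp, monomial_comp, ← h, ← hlead]
      simp) rfl
  exact ⟨Q₁ + monomial Q.natDegree P.leadingCoeff, by
    rw [Polynomial.map_add, map_monomial, hQ₁, hlead, eraseLead_add_monomial_natDegree_leadingCoeff]⟩

/-- In a decomposition `P = Q ∘ R` with `R` monic and `P` over the base field, the coefficients of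
`R ^ deg Q` above degree `(deg Q - 1) * deg R` lie in the base field. -/
theorem Polynomial.coeff_pow_mem_fieldRange_of_map_eq_comp {K L : Type*} [Field K] [Field L]
    (f : K →+* L) {P : K[X]} {Q R : L[X]} (hQ : Q ≠ 0) (hR : R.Monic) (hR0 : R.natDegree ≠ 0)
    (h : P.map f = Q.comp R) {n : ℕ} (hn : (Q.natDegree - 1) * R.natDegree < n) :
    (R ^ Q.natDegree).coeff n ∈ f.fieldRange := by
  have hlead : f P.leadingCoeff = Q.leadingCoeff := by
    rw [← leadingCoeff_map, h, leadingCoeff_comp hR0, hR.leadingCoeff, one_pow, mul_one]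
  have hcoeff : f (P.coeff n) = Q.leadingCoeff * (R ^ Q.natDegree).coeff n := by
    rw [← coeff_map, h, ← Q.eraseLead_add_C_mul_X_pow, add_comp, coeff_add,
      coeff_eq_zero_of_natDegree_lt, Q.eraseLead_add_C_mul_X_pow, zero_add, mul_comp, C_comp,
      X_pow_comp, coeff_C_mul]
    rw [natDegree_comp]
    exact (Nat.mul_le_mul_right _ (eraseLead_natDegree_le Q)).trans_lt hn
  refine ⟨P.leadingCoeff⁻¹ * P.coeff n, ?_⟩
  rw [map_mul, map_inv₀, hcoeff, hlead, inv_mul_cancel_left₀ (leadingCoeff_ne_zero.2 hQ)]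

/-- Theorem 3.3(a): if `P ∈ K[X]` has a `(q,r)` decomposition over a field
extension `L`, then `P` has a normal `(q,r)` decomposition with both
components in `K[X]`. -/
theorem normal_decomposition_over_base_field {K L : Type*} [Field K] [Field L]
    [CharZero K] [CharZero L] (f : K →+* L)
    (P : K[X]) (Q R : L[X]) (q r : ℕ) (hq : 2 ≤ q) (hr : 2 ≤ r)
    (hQ : Q.natDegree = q) (hR : R.natDegree = r)
    (h : P.map f = Q.comp R) :
    ∃ Q₀ R₀ : K[X], Q₀.natDegree = q ∧ R₀.natDegree = r ∧
      R₀.Monic ∧ R₀.coeff 0 = 0 ∧ P = Q₀.comp R₀ := by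
  have hR0 : R ≠ 0 := by rintro rfl; simp at hR; lia
  have hl : R.leadingCoeff ≠ 0 := leadingCoeff_ne_zero.2 hR0
  set R₁ := R * C R.leadingCoeff⁻¹ with hR₁
  set Q₁ := Q.comp (C R.leadingCoeff * X) with hQ₁
  have hR₁m : R₁.Monic := monic_mul_leadingCoeff_inv hR0
  have hR₁r : R₁.natDegree = r := by
    rw [hR₁, natDegree_mul_C (inv_ne_zero hl), hR]
  have hQ₁q : Q₁.natDegree = q := by
    rw [hQ₁, natDegree_comp, natDegree_C_mul_X _ hl, mul_one, hQ]
  have hQ₁0 : Q₁ ≠ 0 := by rintro h0; simp [h0] at hQ₁q; lia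
  have h₁ : P.map f = Q₁.comp R₁ := by
    rw [h, hQ₁, comp_assoc, mul_comp, C_comp, X_comp, hR₁, mul_left_comm, ← C_mul,
      mul_inv_cancel₀ hl, C_1, mul_one]
  obtain ⟨A, hA, hAr, c, hc⟩ := exists_monic_map_add_C_of_coeff_pow_mem f hR₁m (q := Q₁.natDegree)
    (by lia) fun n hn => coeff_pow_mem_fieldRange_of_map_eq_comp f hQ₁0 hR₁m (by lia) h₁ hn
  have hR₀r : (A - C (A.coeff 0)).natDegree = r := by rw [natDegree_sub_C, hAr, hR₁r]
  have hR₀m : (A - C (A.coeff 0)).Monic :=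
    hA.sub_of_left (degree_C_le.trans_lt (natDegree_pos_iff_degree_pos.1 (by lia)))
  have h₂ : P.map f = (Q₁.comp (X + C (c + f (A.coeff 0)))).comp ((A - C (A.coeff 0)).map f) := by
    rw [h₁, comp_assoc Q₁ (X + _), hc]
    congr 1
    simp
  obtain ⟨Q₀, hQ₀⟩ := exists_map_eq_of_map_eq_comp f hR₀m (by lia) h₂
  refine ⟨Q₀, A - C (A.coeff 0), ?_, hR₀r, hR₀m, by simp, ?_⟩
  · rw [← natDegree_map f, hQ₀, natDegree_comp, natDegree_X_add_C, mul_one, hQ₁q]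
  · apply map_injective f f.injective
    rw [map_comp, hQ₀, h₂]
end

section
/- Let K be a field of characteristic 0 and let P = Q ∘ R in K[X], where deg Q = q ≥ 1, deg R = r ≥ 2, R is monic and R has constant coefficient 0; set n = q·r = deg P. Then the coefficient of X^{n−1} in P is zero if and only if the coefficient of X^{r−1} in R is zero. Moreover, if e is an index with 1 ≤ e ≤ r−1 such that the coefficient of X^e in R is nonzero while the coefficients of X^i in R vanish for all i with e < i < r, then the coefficient of X^k in P vanishes for all k with n−(r−e) < k < n and the coefficient of X^{n−(r−e)} in P is nonzero; that is, P and R have the same descent r − e. -/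
open Polynomial

theorem Polynomial.X_pow_succ_dvd_pow_sub {A : Type*} [CommRing A] {d : ℕ} (hd : 1 ≤ d)
    {f : A[X]} {c : A} (hf : X ^ (d + 1) ∣ f - (1 + C c * X ^ d)) (m : ℕ) :
    X ^ (d + 1) ∣ f ^ m - (1 + C (m * c) * X ^ d) := by
  induction m with
  | zero => simp
  | succ m ih =>
    obtain ⟨t, ht⟩ := hf
    obtain ⟨s, hs⟩ := ih
    obtain ⟨b, rfl⟩ := Nat.exists_eq_add_of_le' hd
    refine ⟨s * f + (1 + C (m * c) * X ^ (b + 1)) * t + C (m * c) * C c * X ^ b, ?_⟩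
    push_cast
    simp only [C_add, C_mul, add_mul, one_mul] at *
    linear_combination f * hs + (1 + C (m : A) * C c * X ^ (b + 1)) * ht

/-- If the coefficients of a monic `R` of degree `r` vanish strictly between `r - d` and `r`, then
the coefficients of `R ^ m` strictly between `m * r - d` and `m * r` vanish as well, and the one at
`m * r - d` is `m` times the coefficient of `R` at `r - d`. -/
theorem Polynomial.Monic.coeff_pow_of_gap {A : Type*} [CommRing A] [IsDomain A] {R : A[X]}
    (hR : R.Monic) {d : ℕ} (hd : 1 ≤ d) (hdr : d ≤ R.natDegree)
    (hgap : ∀ i, R.natDegree - d < i → i < R.natDegree → R.coeff i = 0) {m : ℕ} (hm : 1 ≤ m)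
    {k : ℕ} (hk : 1 ≤ k) (hkd : k ≤ d) :
    (R ^ m).coeff (m * R.natDegree - k) =
      if k = d then m * R.coeff (R.natDegree - d) else 0 := by
  have hrev : X ^ (d + 1) ∣ R.reverse - (1 + C (R.coeff (R.natDegree - d)) * X ^ d) := by
    rw [X_pow_dvd_iff]
    intro i hi
    rw [coeff_sub, coeff_add, coeff_C_mul_X_pow, coeff_reverse, revAt_le (by omega), coeff_one]
    rcases Nat.eq_zero_or_pos i with rfl | hi0
    · have hd0 : 0 ≠ d := by omega
      simp [hd0, hR.leadingCoeff]
    · by_cases hid : i = d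
      · subst hid
        simp [hi0.ne']
      · simp [hid, hi0.ne', hgap (R.natDegree - i) (by omega) (by omega)]
  have hpow := X_pow_dvd_iff.1 (X_pow_succ_dvd_pow_sub hd hrev m) k (by omega)
  have hrp : (R ^ m).reverse = R.reverse ^ m := by
    clear hpow hm
    induction m with
    | zero => simpa using reverse_C (1 : A)
    | succ m ih => rw [pow_succ, reverse_mul_of_domain, ih, pow_succ]
  have hle : R.natDegree ≤ m * R.natDegree := Nat.le_mul_of_pos_left _ hm
  rw [← hrp, coeff_sub, coeff_add, coeff_C_mul_X_pow, coeff_reverse, hR.natDegree_pow,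
    revAt_le (by omega), coeff_one, if_neg (by omega), zero_add, sub_eq_zero] at hpow
  exact hpow

/-- The composition analogue of `Polynomial.Monic.coeff_pow_of_gap`. -/
theorem Polynomial.Monic.coeff_comp_of_gap {A : Type*} [CommRing A] [IsDomain A] {Q R : A[X]}
    (hR : R.Monic) (hQ : 1 ≤ Q.natDegree) {d : ℕ} (hd : 1 ≤ d) (hdr : d < R.natDegree)
    (hgap : ∀ i, R.natDegree - d < i → i < R.natDegree → R.coeff i = 0)
    {k : ℕ} (hk : 1 ≤ k) (hkd : k ≤ d) :
    (Q.comp R).coeff (Q.natDegree * R.natDegree - k) =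
      if k = d then Q.leadingCoeff * (Q.natDegree * R.coeff (R.natDegree - d)) else 0 := by
  have hlow : (Q.eraseLead.comp R).natDegree < Q.natDegree * R.natDegree - k := by
    have h1 : Q.eraseLead.natDegree * R.natDegree ≤ (Q.natDegree - 1) * R.natDegree :=
      Nat.mul_le_mul_right _ Q.eraseLead_natDegree_le
    have h2 := natDegree_comp_le (p := Q.eraseLead) (q := R)
    have h3 : R.natDegree ≤ Q.natDegree * R.natDegree := Nat.le_mul_of_pos_left _ hQ
    rw [Nat.sub_mul, one_mul] at h1
    omega
  have hcomp : Q.comp R = Q.eraseLead.comp R + C Q.leadingCoeff * R ^ Q.natDegree := by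
    conv_lhs => rw [← Q.eraseLead_add_C_mul_X_pow, add_comp, mul_comp, C_comp, X_pow_comp]
  rw [hcomp, coeff_add, coeff_eq_zero_of_natDegree_lt hlow, zero_add, coeff_C_mul,
    hR.coeff_pow_of_gap hd hdr.le hgap hQ hk hkd, mul_ite, mul_zero]

/-- Theorem 3.3(b₂): in a normal decomposition `P = Q ∘ R` (`R` monic with
constant coefficient `0`, `deg Q = q`, `deg R = r`, `n = q * r`), `P` is a
ϱ-polynomial iff `R` is, and in that case `P` and `R` have the same descent. -/
theorem normal_decomposition_rho_descent {K : Type*} [Field K] [CharZero K]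
    (P Q R : K[X]) (q r n : ℕ) (hq : 1 ≤ q) (hr : 2 ≤ r)
    (hQ : Q.natDegree = q) (hR : R.natDegree = r) (hn : n = q * r)
    (hRm : R.Monic) (hR0 : R.coeff 0 = 0) (h : P = Q.comp R) :
    (P.coeff (n - 1) = 0 ↔ R.coeff (r - 1) = 0) ∧
    (∀ e : ℕ, 1 ≤ e → e ≤ r - 1 → R.coeff e ≠ 0 →
      (∀ i : ℕ, e < i → i < r → R.coeff i = 0) →
      ((∀ k : ℕ, n - (r - e) < k → k < n → P.coeff k = 0) ∧
        P.coeff (n - (r - e)) ≠ 0)) := by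
  subst hQ hR hn h
  have hQ0 : Q.leadingCoeff ≠ 0 := leadingCoeff_ne_zero.2 (ne_zero_of_natDegree_gt hq)
  have hq0 : (Q.natDegree : K) ≠ 0 := Nat.cast_ne_zero.2 (by omega)
  refine ⟨?_, fun e he her hRe hgap => ?_⟩
  · rw [hRm.coeff_comp_of_gap hq le_rfl hr (fun i _ _ => by omega) le_rfl le_rfl]
    simp [hQ0, hq0]
  · have key := fun {k : ℕ} => hRm.coeff_comp_of_gap (k := k) hq
      (d := R.natDegree - e) (by omega) (by omega) (fun i _ _ => hgap i (by omega) (by omega))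
    refine ⟨fun k hk1 hk2 => ?_, ?_⟩
    · have hk := key (k := Q.natDegree * R.natDegree - k) (by omega) (by omega)
      rwa [if_neg (by omega), Nat.sub_sub_self hk2.le] at hk
    · rw [key (by omega) le_rfl, if_pos rfl, Nat.sub_sub_self (by omega)]
      exact mul_ne_zero hQ0 (mul_ne_zero hq0 hRe)
end

section
/- Let K be a field of characteristic 0 and let P ∈ K[X] be a δ-polynomial of degree n. If P = Q ∘ R is a normal (q,r) decomposition (deg Q = q ≥ 2, deg R = r ≥ 2, R monic with constant coefficient 0), then R is a δ-polynomial. -/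
open Polynomial

/-- For monic `Q` and `R`, where `R` has a nonconstant term below the leading one, the part of
`Q.comp R` below the leading term has the degree and top coefficient of `deg Q • X ^ ((deg Q - 1) deg R)`
times `R.eraseLead`. -/
lemma exists_comp_eq_X_pow_add {K : Type*} [Field K] {Q R : K[X]} (hQm : Q.Monic) (hRm : R.Monic)
    (hQ : 1 ≤ Q.natDegree) (hk : 1 ≤ R.eraseLead.natDegree) :
    ∃ T : K[X], Q.comp R = X ^ (Q.natDegree * R.natDegree) + T ∧
      T.natDegree ≤ R.eraseLead.natDegree + (Q.natDegree - 1) * R.natDegree ∧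
      T.coeff (R.eraseLead.natDegree + (Q.natDegree - 1) * R.natDegree) =
        R.eraseLead.leadingCoeff * Q.natDegree := by
  set q := Q.natDegree with hq
  set r := R.natDegree with hr
  set S := R.eraseLead
  set G : K[X] := ∑ i ∈ Finset.range q, R ^ i * (X ^ r) ^ (q - 1 - i) with hG
  have hterm : ∀ i ∈ Finset.range q, (R ^ i * (X ^ r) ^ (q - 1 - i)).Monic ∧
      (R ^ i * (X ^ r) ^ (q - 1 - i)).natDegree = (q - 1) * r := by
    intro i hi
    have hi' : i + (q - 1 - i) = q - 1 := by
      have := Finset.mem_range.mp hi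
      omega
    have hX : ((X ^ r : K[X]) ^ (q - 1 - i)).Monic := (monic_X_pow r).pow _
    refine ⟨(hRm.pow i).mul hX, ?_⟩
    rw [(hRm.pow i).natDegree_mul hX, hRm.natDegree_pow, natDegree_pow, natDegree_X_pow,
      ← hr, ← add_mul, hi']
  have hGdeg : G.natDegree ≤ (q - 1) * r :=
    natDegree_sum_le_of_forall_le _ _ fun i hi => (hterm i hi).2.le
  have hGcoeff : G.coeff ((q - 1) * r) = q := by
    rw [hG, finsetSum_coeff, Finset.sum_congr rfl (g := fun _ => (1 : K))]
    · simp
    · intro i hi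
      rw [← (hterm i hi).2]
      exact (hterm i hi).1.coeff_natDegree
  have hRS : R - X ^ r = S := by
    have := R.eraseLead_add_monomial_natDegree_leadingCoeff
    rw [hRm.leadingCoeff, ← X_pow_eq_monomial] at this
    exact sub_eq_of_eq_add this.symm
  have hpow : R ^ q = X ^ (q * r) + S * G := by
    have := (Commute.all R (X ^ r)).mul_geom_sum₂ q
    rw [hRS, ← pow_mul, mul_comm r q] at this
    rw [hG, this]
    ring
  have hQe : Q = Q.eraseLead + X ^ q := by
    have := Q.eraseLead_add_monomial_natDegree_leadingCoeff
    rw [hQm.leadingCoeff, ← X_pow_eq_monomial] at this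
    exact this.symm
  have hlow : (Q.eraseLead.comp R).natDegree ≤ (q - 1) * r :=
    natDegree_comp_le.trans (Nat.mul_le_mul_right _ Q.eraseLead_natDegree_le)
  refine ⟨S * G + Q.eraseLead.comp R, ?_, ?_, ?_⟩
  · conv_lhs => rw [hQe]
    rw [add_comp, X_pow_comp, hpow]
    ring
  · exact natDegree_add_le_of_degree_le (natDegree_mul_le.trans (Nat.add_le_add_left hGdeg _))
      (hlow.trans (Nat.le_add_left _ _))
  · rw [coeff_add, coeff_mul_add_eq_of_natDegree_le le_rfl hGdeg, hGcoeff, coeff_natDegree,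
      coeff_eq_zero_of_natDegree_lt (p := Q.eraseLead.comp R) (by omega), add_zero]

/-- Corollary 3.4: in a normal `(q,r)` decomposition `P = Q ∘ R` of a
δ-polynomial `P`, the right factor `R` is again a δ-polynomial. -/
theorem delta_decomposition {K : Type*} [Field K] [CharZero K]
    (P Q R : K[X]) (q r : ℕ) (hq : 2 ≤ q) (hr : 2 ≤ r)
    (hQ : Q.natDegree = q) (hR : R.natDegree = r)
    (hRm : R.Monic) (hR0 : R.coeff 0 = 0)
    (hP : IsDeltaPoly P) (h : P = Q.comp R) :
    IsDeltaPoly R := by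
  have hPm : P.Monic := by
    rcases hP with hX | hP
    · rw [hX]
      exact monic_X_pow _
    · exact hP.1
  have hPdeg : P.natDegree = q * r := by rw [h, natDegree_comp, hQ, hR]
  have hQm : Q.Monic := by
    have hlc := leadingCoeff_comp (p := Q) (q := R) (by omega)
    rwa [← h, hPm.leadingCoeff, hRm.leadingCoeff, one_pow, mul_one, eq_comm] at hlc
  by_cases hS : R.eraseLead = 0
  · left
    have := R.eraseLead_add_monomial_natDegree_leadingCoeff
    rw [hRm.leadingCoeff, ← X_pow_eq_monomial, hS, zero_add] at this
    exact this.symm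
  have hcS : R.eraseLead.leadingCoeff ≠ 0 := leadingCoeff_ne_zero.mpr hS
  have hk : 1 ≤ R.eraseLead.natDegree := by
    rw [Nat.one_le_iff_ne_zero]
    intro h0
    apply hcS
    rw [leadingCoeff, h0, eraseLead_coeff_of_ne 0 (by omega), hR0]
  have hkr : R.eraseLead.natDegree < r := by
    have := R.eraseLead_natDegree_le
    omega
  obtain ⟨T, hT, hTdeg, hTc⟩ := exists_comp_eq_X_pow_add hQm hRm (by omega) hk
  rw [hQ, hR] at hTdeg hTc hT
  have hRc : R.coeff R.eraseLead.natDegree = R.eraseLead.leadingCoeff := by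
    rw [leadingCoeff, eraseLead_coeff_of_ne _ (by omega)]
  set k := R.eraseLead.natDegree
  have hqr : q * r = (q - 1) * r + r := by
    obtain ⟨m, rfl⟩ : ∃ m, q = m + 1 := ⟨q - 1, by omega⟩
    simp [Nat.add_mul]
  have hq0 : (q : K) ≠ 0 := Nat.cast_ne_zero.mpr (by omega)
  have hPk : P.coeff (k + (q - 1) * r) = R.eraseLead.leadingCoeff * q := by
    rw [h, hT, coeff_add, hTc, coeff_X_pow, if_neg (by omega), zero_add]
  have hPk0 : P.coeff (k + (q - 1) * r) ≠ 0 := hPk ▸ mul_ne_zero hcS hq0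
  have hPhigh : ∀ i, k + (q - 1) * r < i → i < q * r → P.coeff i = 0 := by
    intro i hi hi'
    rw [h, hT, coeff_add, coeff_X_pow, if_neg (by omega), zero_add,
      coeff_eq_zero_of_natDegree_lt (by omega)]
  right
  rcases hP with hX | ⟨-, -, e, -, he2, hec, hez⟩
  · rw [hX, coeff_X_pow, if_neg (by omega)] at hPk0
    exact absurd rfl hPk0
  · rw [hPdeg] at he2 hec hez
    have hek : e = k + (q - 1) * r := by
      rcases lt_trichotomy e (k + (q - 1) * r) with hlt | heq | hgt
      · exact absurd (hez _ hlt (by omega)) hPk0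
      · exact heq
      · rw [hPhigh e hgt (by omega), eq_comm, Nat.cast_eq_zero] at hec
        omega
    refine ⟨hRm, hR0, k, hk, by omega, ?_, ?_⟩
    · rw [hek, hPk, Nat.cast_mul, mul_comm] at hec
      rw [hRc, hR]
      exact mul_left_cancel₀ hq0 hec
    · intro i hi hi'
      rw [← eraseLead_coeff_of_ne i hi'.ne]
      exact coeff_eq_zero_of_natDegree_lt hi
end

section
/- Let n ≥ 2 and write Φ_n(X) = X^{φ(n)} + c_{φ(n)−1}X^{φ(n)−1} + … + c_1 X + c_0 in ℚ[X]. Then c_0 = 1 and c_1 = c_{φ(n)−1} = −μ(n), where μ is the Möbius function; explicitly, c_1 = c_{φ(n)−1} = (−1)^{s+1} if n is a product of s distinct primes, and c_1 = c_{φ(n)−1} = 0 if p² ∣ n for some prime p. -/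
open Polynomial

theorem eq_neg_moebius_of_sum_divisors {R : Type*} [CommRing R] {f : ℕ → R}
    (h : ∀ n > 0, ∑ d ∈ n.divisors, f d = if n = 1 then -1 else 0) {n : ℕ} (hn : 0 < n) :
    f n = -(ArithmeticFunction.moebius n : R) := by
  rw [← ArithmeticFunction.sum_eq_iff_sum_mul_moebius_eq.1 h n hn,
    Finset.sum_eq_single_of_mem (n, 1) (by simp [hn.ne'])]
  · simp
  · rintro ⟨a, b⟩ hab hne
    have hb : b ≠ 1 := by
      rintro rfl
      simp_all
    simp [hb]

theorem nextCoeff_X_pow_sub_one {R : Type*} [CommRing R] [Nontrivial R] {n : ℕ} (hn : 0 < n) :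
    (X ^ n - 1 : R[X]).nextCoeff = if n = 1 then -1 else 0 := by
  have hdeg : (X ^ n - 1 : R[X]).natDegree = n := by
    simpa using natDegree_X_pow_sub_C (R := R) (n := n) (r := 1)
  rw [nextCoeff_of_natDegree_pos (by rwa [hdeg]), hdeg, coeff_sub, coeff_X_pow, coeff_one]
  have h₁ : n - 1 ≠ n := by omega
  have h₂ : n - 1 = 0 ↔ n = 1 := by omega
  split_ifs <;> simp_all

theorem nextCoeff_cyclotomic {R : Type*} [CommRing R] [Nontrivial R] {n : ℕ} (hn : 0 < n) :
    (cyclotomic n R).nextCoeff = -(ArithmeticFunction.moebius n : R) := by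
  refine eq_neg_moebius_of_sum_divisors (f := fun d => (cyclotomic d R).nextCoeff) ?_ hn
  intro m hm
  rw [← Monic.nextCoeff_prod _ _ fun d _ => cyclotomic.monic d R,
    prod_cyclotomic_eq_X_pow_sub_one hm, nextCoeff_X_pow_sub_one hm]

theorem coeff_one_prod_div_coeff_zero {ι K : Type*} [Field K] (s : Finset ι) (p : ι → K[X])
    (hp : ∀ i ∈ s, (p i).coeff 0 ≠ 0) :
    (∏ i ∈ s, p i).coeff 1 / (∏ i ∈ s, p i).coeff 0 =
      ∑ i ∈ s, (p i).coeff 1 / (p i).coeff 0 := by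
  classical
  induction s using Finset.induction_on with
  | empty => simp [coeff_one]
  | insert a s ha ih =>
    have h₀ : (p a).coeff 0 ≠ 0 := hp a (Finset.mem_insert_self a s)
    have hs : ∀ i ∈ s, (p i).coeff 0 ≠ 0 := fun i hi => hp i (Finset.mem_insert_of_mem hi)
    have h₁ : (∏ i ∈ s, p i).coeff 0 ≠ 0 := by
      rw [coeff_zero_prod]
      exact Finset.prod_ne_zero_iff.2 hs
    rw [Finset.prod_insert ha, Finset.sum_insert ha, ← ih hs, mul_coeff_one, mul_coeff_zero]
    field_simp
    ring

theorem coeff_zero_cyclotomic_ne_zero {R : Type*} [CommRing R] [Nontrivial R] (n : ℕ) :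
    (cyclotomic n R).coeff 0 ≠ 0 := by
  obtain rfl | rfl | hn : n = 0 ∨ n = 1 ∨ 1 < n := by omega
  · simp
  · simp
  · simp [cyclotomic_coeff_zero R hn]

theorem coeff_one_cyclotomic {K : Type*} [Field K] {n : ℕ} (hn : 1 < n) :
    (cyclotomic n K).coeff 1 = -(ArithmeticFunction.moebius n : K) := by
  have key := eq_neg_moebius_of_sum_divisors (R := K) (n := n)
    (f := fun d => (cyclotomic d K).coeff 1 / (cyclotomic d K).coeff 0) ?_ (by omega)
  · simpa [cyclotomic_coeff_zero K hn] using key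
  · intro m hm
    rw [← coeff_one_prod_div_coeff_zero _ _ fun d _ => coeff_zero_cyclotomic_ne_zero d,
      prod_cyclotomic_eq_X_pow_sub_one hm]
    by_cases h₁ : m = 1
    · simp [h₁, coeff_one]
    · simp [coeff_X_pow, coeff_one, h₁, Ne.symm h₁]

theorem coeff_totient_sub_one_cyclotomic {R : Type*} [CommRing R] [Nontrivial R] {n : ℕ}
    (hn : 0 < n) :
    (cyclotomic n R).coeff (n.totient - 1) = -(ArithmeticFunction.moebius n : R) := by
  rw [← nextCoeff_cyclotomic hn, nextCoeff_of_natDegree_pos, natDegree_cyclotomic]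
  rw [natDegree_cyclotomic]
  exact Nat.totient_pos.2 hn

theorem moebius_eq_neg_one_pow_card_primeFactors {n : ℕ} (hn : Squarefree n) :
    ArithmeticFunction.moebius n = (-1) ^ n.primeFactors.card := by
  rw [ArithmeticFunction.moebius_apply_of_squarefree hn,
    ← (ArithmeticFunction.cardDistinctFactors_eq_cardFactors_iff_squarefree hn.ne_zero).2 hn,
    ArithmeticFunction.cardDistinctFactors_apply, Nat.primeFactors, List.card_toFinset]

/-- Proposition 4.3: for `n ≥ 2`, the constant coefficient of `Φ_n` is `1`
and the coefficients of `X` and of `X^(φ(n)-1)` both equal `-μ(n)`;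
explicitly, they equal `(-1)^(s+1)` when `n` is a product of `s` distinct
primes and `0` when `p² ∣ n` for some prime `p`. -/
theorem cyclotomic_small_coeffs (n : ℕ) (hn : 2 ≤ n) :
    (cyclotomic n ℚ).coeff 0 = 1 ∧
    (cyclotomic n ℚ).coeff 1 = -(ArithmeticFunction.moebius n : ℚ) ∧
    (cyclotomic n ℚ).coeff (n.totient - 1) = -(ArithmeticFunction.moebius n : ℚ) ∧
    (Squarefree n →
      (cyclotomic n ℚ).coeff 1 = (-1) ^ (n.primeFactors.card + 1) ∧
      (cyclotomic n ℚ).coeff (n.totient - 1) = (-1) ^ (n.primeFactors.card + 1)) ∧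
    ((∃ p : ℕ, p.Prime ∧ p ^ 2 ∣ n) →
      (cyclotomic n ℚ).coeff 1 = 0 ∧
      (cyclotomic n ℚ).coeff (n.totient - 1) = 0) := by
  have h₁ := coeff_one_cyclotomic (K := ℚ) (n := n) hn
  have h₂ := coeff_totient_sub_one_cyclotomic (R := ℚ) (n := n) (by omega)
  refine ⟨cyclotomic_coeff_zero ℚ hn, h₁, h₂, fun hsq => ?_, ?_⟩
  · rw [h₁, h₂, moebius_eq_neg_one_pow_card_primeFactors hsq]
    simp [pow_succ]
  · rintro ⟨p, hp, hdvd⟩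
    have hsq : ¬Squarefree n := fun h =>
      hp.one_lt.ne' (Nat.isUnit_iff.1 (h p (by rwa [← sq])))
    rw [h₁, h₂, ArithmeticFunction.moebius_eq_zero_of_not_squarefree hsq]
    simp
end

section
/- If n is a squarefree natural number, then the cyclotomic polynomial Φ_n is indecomposable over ℚ: there do not exist Q, R ∈ ℚ[X] with deg Q ≥ 2, deg R ≥ 2 and Φ_n = Q ∘ R. -/
open Polynomial

namespace Polynomial

section Ring

variable {K : Type*} [Ring K] {R : K[X]}

lemma nextCoeff_sub_C (hR : 2 ≤ R.natDegree) (a : K) : (R - C a).nextCoeff = R.nextCoeff := by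
  have h : (R - C a).natDegree = R.natDegree := natDegree_sub_C
  rw [nextCoeff_of_natDegree_pos (by omega), nextCoeff_of_natDegree_pos (by omega), h, coeff_sub,
    coeff_C_of_ne_zero (by omega), sub_zero]

lemma Monic.sub_C (hm : R.Monic) (hR : 1 ≤ R.natDegree) (a : K) : (R - C a).Monic :=
  hm.sub_of_left (degree_C_le.trans_lt (natDegree_pos_iff_degree_pos.1 hR))

end Ring

lemma Splits.comp_eq_prod_sub_C {K : Type*} [Field K] {Q : K[X]} (hQs : Q.Splits) (hQ : Q.Monic)
    (R : K[X]) : Q.comp R = (Q.roots.map fun a => R - C a).prod := by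
  conv_lhs => rw [hQs.eq_prod_roots_of_monic hQ]
  simp [multiset_prod_comp, Multiset.map_map]

/-- The coefficient following the leading one in a composition of monic polynomials. -/
lemma Splits.nextCoeff_comp {K : Type*} [Field K] {Q R : K[X]} (hQs : Q.Splits) (hQ : Q.Monic)
    (hR : R.Monic) (hR2 : 2 ≤ R.natDegree) :
    (Q.comp R).nextCoeff = Q.natDegree • R.nextCoeff := by
  rw [hQs.comp_eq_prod_sub_C hQ, Monic.nextCoeff_multiset_prod _ _
    fun a _ => hR.sub_C (by omega) a]
  simp [nextCoeff_sub_C hR2, hQs.natDegree_eq_card_roots]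

/-- If all roots of the composition are integral, so is the coefficient following the leading one
in the inner polynomial. -/
lemma isIntegral_nextCoeff_of_comp {K : Type*} [Field K] [IsAlgClosed K] {Q R : K[X]}
    (hQ : Q.natDegree ≠ 0) (hR : R.Monic) (hR2 : 2 ≤ R.natDegree)
    (h : ∀ x, (Q.comp R).IsRoot x → IsIntegral ℤ x) : IsIntegral ℤ R.nextCoeff := by
  obtain ⟨a, ha⟩ := IsAlgClosed.exists_root Q
    fun hd => hQ (natDegree_eq_of_degree_eq_some hd)
  rw [← nextCoeff_sub_C hR2 a, (IsAlgClosed.splits _).nextCoeff_eq_neg_sum_roots_of_monic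
    (hR.sub_C (by omega) a)]
  refine (IsIntegral.multiset_sum fun x hx => h x ?_).neg
  have hx' : R.eval x = a := by simpa [sub_eq_zero] using isRoot_of_mem_roots hx
  simpa [IsRoot, eval_comp, hx'] using ha

/-- A decomposition over `ℚ` of a monic integer polynomial. -/
lemma natDegree_dvd_nextCoeff_of_map_eq_comp_of_monic {F : ℤ[X]} (hF : F.Monic) {Q R : ℚ[X]}
    (hQ : Q.Monic) (hR : R.Monic) (hQ1 : Q.natDegree ≠ 0) (hR2 : 2 ≤ R.natDegree)
    (h : F.map (Int.castRingHom ℚ) = Q.comp R) : (Q.natDegree : ℤ) ∣ F.nextCoeff := by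
  let i := algebraMap ℚ (AlgebraicClosure ℚ)
  have hmap : F.map (i.comp (Int.castRingHom ℚ)) = (Q.map i).comp (R.map i) := by
    rw [← map_map, h, map_comp]
  have hint : IsIntegral ℤ (R.map i).nextCoeff := by
    refine isIntegral_nextCoeff_of_comp (Q := Q.map i) (by simpa using hQ1) (hR.map i)
      (by simpa using hR2) fun x hx => ⟨F, hF, ?_⟩
    rw [← hmap, IsRoot, eval_map, RingHom.ext_int (i.comp (Int.castRingHom ℚ)) (algebraMap ℤ _)] at hx
    exact hx
  rw [nextCoeff_map i.injective, isIntegral_algebraMap_iff i.injective] at hint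
  obtain ⟨z, hz⟩ := IsIntegrallyClosed.isIntegral_iff.1 hint
  have hn := (IsAlgClosed.splits (Q.map i)).nextCoeff_comp (hQ.map i) (hR.map i)
    (by simpa using hR2)
  rw [← map_comp, ← h, nextCoeff_map i.injective, nextCoeff_map i.injective, ← map_nsmul,
    nextCoeff_map (RingHom.injective_int _), natDegree_map] at hn
  have hn' := i.injective hn
  rw [← hz] at hn'
  refine ⟨z, ?_⟩
  simp only [nsmul_eq_mul, eq_intCast] at hn'
  exact_mod_cast hn'

lemma natDegree_dvd_nextCoeff_of_map_eq_comp {F : ℤ[X]} (hF : F.Monic) {Q R : ℚ[X]}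
    (hQ1 : Q.natDegree ≠ 0) (hR2 : 2 ≤ R.natDegree)
    (h : F.map (Int.castRingHom ℚ) = Q.comp R) : (Q.natDegree : ℤ) ∣ F.nextCoeff := by
  have hR0 : R ≠ 0 := by rintro rfl; simp at hR2
  have hc : R.leadingCoeff ≠ 0 := leadingCoeff_ne_zero.2 hR0
  have hlin : (C R.leadingCoeff * X).natDegree = 1 := natDegree_C_mul_X _ hc
  have hcomp : (Q.comp (C R.leadingCoeff * X)).comp (C R.leadingCoeff⁻¹ * R) = Q.comp R := by
    rw [comp_assoc]
    congr 1
    simp [← mul_assoc, ← C_mul, hc]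
  have hdeg : (Q.comp (C R.leadingCoeff * X)).natDegree = Q.natDegree := by
    rw [natDegree_comp, hlin, mul_one]
  have hQm : (Q.comp (C R.leadingCoeff * X)).Monic := by
    have hlc := (hF.map (Int.castRingHom ℚ)).leadingCoeff
    rw [h, leadingCoeff_comp (by omega)] at hlc
    rw [Monic, leadingCoeff_comp (by omega), leadingCoeff_mul, leadingCoeff_C, leadingCoeff_X,
      mul_one, hlc]
  rw [← hdeg]
  refine natDegree_dvd_nextCoeff_of_map_eq_comp_of_monic hF hQm
    (R := C R.leadingCoeff⁻¹ * R) ?_ (by omega) ?_ (by rw [h, hcomp])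
  · rw [Monic, leadingCoeff_mul, leadingCoeff_C, inv_mul_cancel₀ hc]
  · rwa [natDegree_C_mul (inv_ne_zero hc)]

lemma nextCoeff_expand {S : Type*} [CommSemiring S] {p : ℕ} (hp : 2 ≤ p) (f : S[X]) :
    (expand S p f).nextCoeff = 0 := by
  rw [nextCoeff_eq_zero]
  by_cases hf : f.natDegree = 0
  · exact .inl (by simp [natDegree_expand, hf])
  have hpos : 0 < f.natDegree * p := by positivity
  refine .inr ⟨by rwa [natDegree_expand], ?_⟩
  rw [natDegree_expand, coeff_expand (by omega), if_neg]
  intro hd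
  have h1 := (Nat.dvd_sub_iff_right (by omega) (dvd_mul_left p f.natDegree)).1 hd
  have := Nat.le_of_dvd one_pos h1
  omega

lemma nextCoeff_cyclotomic_mul_prime {p n : ℕ} (hp : p.Prime) (hdiv : ¬p ∣ n) :
    (cyclotomic (n * p) ℤ).nextCoeff = -(cyclotomic n ℤ).nextCoeff := by
  have h := nextCoeff_expand hp.two_le (cyclotomic n ℤ)
  rw [cyclotomic_expand_eq_cyclotomic_mul hp hdiv,
    (cyclotomic.monic _ ℤ).nextCoeff_mul (cyclotomic.monic _ ℤ)] at h
  exact eq_neg_of_add_eq_zero_left h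

lemma isUnit_nextCoeff_cyclotomic {n : ℕ} (hn : Squarefree n) :
    IsUnit (cyclotomic n ℤ).nextCoeff := by
  induction n using induction_on_primes with
  | zero => exact absurd hn not_squarefree_zero
  | one => rw [cyclotomic_one, ← C_1, nextCoeff_X_sub_C]; exact isUnit_one.neg
  | prime_mul p n hp ih =>
    have hdiv : ¬p ∣ n := fun ⟨m, hm⟩ =>
      hp.prime.not_isUnit (hn p ⟨m, by rw [hm, mul_assoc]⟩)
    rw [mul_comm p n, nextCoeff_cyclotomic_mul_prime hp hdiv]
    exact (ih (hn.squarefree_of_dvd (dvd_mul_left n p))).neg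

end Polynomial

/-- Proposition 4.4: the cyclotomic polynomial `Φ_n` of a squarefree `n` is
indecomposable over `ℚ`. -/
theorem cyclotomic_squarefree_indecomposable (n : ℕ) (hn : Squarefree n) :
    ¬ ∃ Q R : ℚ[X], 2 ≤ Q.natDegree ∧ 2 ≤ R.natDegree ∧
      cyclotomic n ℚ = Q.comp R := by
  rintro ⟨Q, R, hQ, hR, h⟩
  rw [← map_cyclotomic_int] at h
  have hu := isUnit_of_dvd_unit (natDegree_dvd_nextCoeff_of_map_eq_comp (cyclotomic.monic n ℤ)
    (by omega) hR h) (isUnit_nextCoeff_cyclotomic hn)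
  rw [Int.ofNat_isUnit, Nat.isUnit_iff] at hu
  omega
end

section
/- Let n ≥ 3. The cyclotomic polynomial Φ_n is indecomposable over ℚ (there do not exist Q, R ∈ ℚ[X] with deg Q ≥ 2, deg R ≥ 2 and Φ_n = Q ∘ R) if and only if n is squarefree or n = 4. -/
open Polynomial

/-- If `n` is squarefree, the primitive `n`-th roots of unity span all `n`-th roots of unity. -/
lemma mem_span_primitiveRoots_of_squarefree {K : Type*} [Field K] [CharZero K] {n : ℕ}
    (hn : Squarefree n) {ζ : K} (hζ : IsPrimitiveRoot ζ n) {x : K} (hx : x ^ n = 1) :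
    x ∈ Submodule.span ℚ (primitiveRoots n K : Set K) := by
  have hn0 : 0 < n := Nat.pos_of_ne_zero hn.ne_zero
  suffices h : ∀ k x, orderOf x * k = n →
      x ∈ Submodule.span ℚ (primitiveRoots n K : Set K) by
    obtain ⟨k, hk⟩ := orderOf_dvd_of_pow_eq_one hx
    exact h k x hk.symm
  clear hx x
  intro k
  induction k using Nat.strong_induction_on with
  | _ k ih =>
    intro x hx
    obtain rfl | hk := eq_or_ne k 1
    · refine Submodule.subset_span ?_
      simp only [Finset.mem_coe, mem_primitiveRoots hn0]
      rw [mul_one] at hx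
      exact hx ▸ IsPrimitiveRoot.orderOf x
    · obtain ⟨p, hp, m, rfl⟩ := Nat.exists_prime_and_dvd hk
      have hm : 0 < m := Nat.pos_of_ne_zero (by rintro rfl; simp at hx; omega)
      have hη : IsPrimitiveRoot (ζ ^ (orderOf x * m)) p :=
        hζ.pow hn0 (by rw [← hx]; ring)
      have hcop : (orderOf x).Coprime p :=
        (Nat.coprime_of_squarefree_mul (hx ▸ hn)).coprime_dvd_right (dvd_mul_right p m)
      have hsum := hη.geom_sum_eq_zero hp.one_lt
      set η := ζ ^ (orderOf x * m)
      obtain ⟨q, rfl⟩ : ∃ q, p = q + 1 := ⟨p - 1, by have := hp.pos; omega⟩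
      rw [Finset.sum_range_succ'] at hsum
      have hx' : x = -∑ i ∈ Finset.range q, x * η ^ (i + 1) := by
        rw [← Finset.mul_sum]
        linear_combination x * hsum
      rw [hx']
      refine Submodule.neg_mem _ (Submodule.sum_mem _ fun i hi => ?_)
      refine ih m (lt_mul_of_one_lt_left hm hp.one_lt) _ ?_
      have hηi : orderOf (η ^ (i + 1)) = q + 1 := by
        refine ((hη.pow_of_coprime (i + 1) ?_).eq_orderOf).symm
        refine (Nat.coprime_of_lt_prime (by omega) ?_ hp).symm
        simpa using hi
      rw [(Commute.all _ _).orderOf_mul_eq_mul_orderOf_of_coprime (by rwa [hηi]), hηi, ← hx,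
        mul_assoc]

/-- If `n` is squarefree, the primitive `n`-th roots of unity are linearly independent over `ℚ`. -/
lemma linearIndepOn_primitiveRoots_of_squarefree {n : ℕ} (hn : Squarefree n) (K : Type*) [Field K]
    [CharZero K] [IsCyclotomicExtension {n} ℚ K] :
    LinearIndepOn ℚ id (primitiveRoots n K : Set K) := by
  have : NeZero n := ⟨hn.ne_zero⟩
  obtain ⟨ζ, hζ⟩ := IsCyclotomicExtension.exists_isPrimitiveRoot ℚ K (Set.mem_singleton n) hn.ne_zero
  refine linearIndependent_of_top_le_span_of_card_eq_finrank
    (b := fun x : (primitiveRoots n K : Set K) => (x : K)) ?_ ?_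
  · rw [Subtype.range_coe, ← (hζ.powerBasis ℚ).basis.span_eq, Submodule.span_le]
    rintro _ ⟨i, rfl⟩
    refine mem_span_primitiveRoots_of_squarefree hn hζ ?_
    rw [PowerBasis.coe_basis, IsPrimitiveRoot.powerBasis_gen, ← pow_mul', pow_mul,
      hζ.pow_eq_one, one_pow]
  · rw [IsCyclotomicExtension.Rat.finrank n K, ← hζ.card_primitiveRoots]
    simp

lemma LinearIndepOn.sum_ne_sum_of_disjoint {R M : Type*} [Ring R] [Nontrivial R] [AddCommGroup M]
    [Module R M] {s : Set M} (hs : LinearIndepOn R id s) {t u : Finset M} (ht : (t : Set M) ⊆ s)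
    (hu : (u : Set M) ⊆ s) (htu : Disjoint t u) (ht' : t.Nonempty) :
    ∑ x ∈ t, x ≠ ∑ x ∈ u, x := by
  classical
  intro h
  have hli : LinearIndepOn R id ((t ∪ u : Finset M) : Set M) :=
    hs.mono (by simpa using ⟨ht, hu⟩)
  rw [linearIndepOn_finset_iff] at hli
  obtain ⟨x, hx⟩ := ht'
  have := hli (fun y => if y ∈ t then 1 else -1) ?_ x (by simp [hx])
  · simp [hx] at this
  · rw [Finset.sum_union htu, Finset.sum_congr rfl (g := fun y => y) (by simp +contextual),
      Finset.sum_congr rfl (s₁ := u) (g := fun y => -y), Finset.sum_neg_distrib, h, add_neg_cancel]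
    intro y hy
    simp [Finset.disjoint_right.mp htu hy]

/-- `Φ_n` is indecomposable over `ℚ` when `n` is squarefree. The roots of `Φ_n` are partitioned by
the fibres of the inner polynomial, and all fibres have the same sum. -/
lemma not_exists_comp_of_squarefree {n : ℕ} (hn : Squarefree n) :
    ¬ ∃ Q R : ℚ[X], 2 ≤ Q.natDegree ∧ 2 ≤ R.natDegree ∧ cyclotomic n ℚ = Q.comp R := by
  classical
  rintro ⟨Q, R, hQ, hR, h⟩
  have : NeZero n := ⟨hn.ne_zero⟩
  let K := CyclotomicField n ℚ
  have : IsCyclotomicExtension {n} ℚ K := by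
    convert CyclotomicField.isCyclotomicExtension n ℚ
    · rfl
    · exact Subsingleton.elim _ _
  obtain ⟨ζ, hζ⟩ := IsCyclotomicExtension.exists_isPrimitiveRoot ℚ K (Set.mem_singleton n) hn.ne_zero
  set S := R.map (algebraMap ℚ K) with hS
  have hSdeg : S.natDegree = R.natDegree := natDegree_map _
  have hcomp : cyclotomic n K = (Q.map (algebraMap ℚ K)).comp S := by
    rw [← map_cyclotomic n (algebraMap ℚ K), h, Polynomial.map_comp]
  have hdeg (β : K) : (S - C β).natDegree = R.natDegree := by rw [natDegree_sub_C, hSdeg]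
  have hne (β : K) : S - C β ≠ 0 := ne_zero_of_natDegree_gt (n := 1) (by rw [hdeg]; omega)
  have hroot {x : K} : x ∈ primitiveRoots n K ↔ (cyclotomic n K).IsRoot x := by
    rw [isRoot_cyclotomic_iff, mem_primitiveRoots (NeZero.pos n)]
  have hdvd {x : K} (hx : x ∈ primitiveRoots n K) : S - C (S.eval x) ∣ cyclotomic n K := by
    have hx' : (Q.map (algebraMap ℚ K)).IsRoot (S.eval x) := by
      have := hroot.mp hx
      rwa [hcomp, IsRoot, eval_comp] at this
    obtain ⟨T, hT⟩ := dvd_iff_isRoot.mpr hx'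
    exact ⟨T.comp S, by rw [hcomp, hT, mul_comp, sub_comp, X_comp, C_comp]⟩
  have hsplit {x : K} (hx : x ∈ primitiveRoots n K) : (S - C (S.eval x)).Splits := by
    have hΦ := IsCyclotomicExtension.splits_cyclotomic ℚ K (Set.mem_singleton n)
    rw [map_cyclotomic] at hΦ
    exact hΦ.of_dvd (cyclotomic_ne_zero n K) (hdvd hx)
  have hsub {x : K} (hx : x ∈ primitiveRoots n K) :
      (((S - C (S.eval x)).roots.toFinset : Finset K) : Set K) ⊆ primitiveRoots n K := by
    intro y hy
    simp only [Finset.mem_coe, Multiset.mem_toFinset] at hy ⊢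
    exact hroot.mpr ((isRoot_of_mem_roots hy).dvd (hdvd hx))
  have hsum {x : K} (hx : x ∈ primitiveRoots n K) :
      ∑ y ∈ (S - C (S.eval x)).roots.toFinset, y = -S.nextCoeff / S.leadingCoeff := by
    have hnodup : (S - C (S.eval x)).roots.Nodup :=
      nodup_roots ((separable_cyclotomic n K).of_dvd (hdvd hx))
    have hnext : (S - C (S.eval x)).nextCoeff = S.nextCoeff := by
      rw [nextCoeff_of_natDegree_pos (by rw [hdeg]; omega),
        nextCoeff_of_natDegree_pos (by rw [hSdeg]; omega), hdeg, hSdeg, coeff_sub,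
        coeff_C_of_ne_zero (by omega), sub_zero]
    have hlead : (S - C (S.eval x)).leadingCoeff = S.leadingCoeff := by
      rw [leadingCoeff, leadingCoeff, hdeg, hSdeg, coeff_sub, coeff_C_of_ne_zero (by omega), sub_zero]
    have hS0 : S.leadingCoeff ≠ 0 :=
      leadingCoeff_ne_zero.mpr (ne_zero_of_natDegree_gt (n := 1) (by rw [hSdeg]; omega))
    have := (hsplit hx).nextCoeff_eq_neg_sum_roots_mul_leadingCoeff
    rw [hnext, hlead] at this
    rw [Finset.sum, Multiset.toFinset_val, hnodup.dedup, Multiset.map_id', this, eq_div_iff hS0]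
    ring
  have hζ' : ζ ∈ primitiveRoots n K := (mem_primitiveRoots (NeZero.pos n)).mpr hζ
  obtain ⟨ξ, hξ, hξζ⟩ : ∃ ξ ∈ primitiveRoots n K, S.eval ξ ≠ S.eval ζ := by
    by_contra! hcon
    have hle : (primitiveRoots n K).card ≤ (S - C (S.eval ζ)).natDegree := by
      refine card_le_degree_of_subset_roots fun y hy => ?_
      rw [mem_roots (hne _), IsRoot, eval_sub, eval_C, hcon y hy, sub_self]
    have hφ : n.totient = Q.natDegree * R.natDegree := by
      rw [← natDegree_cyclotomic n ℚ, h, natDegree_comp]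
    rw [hζ.card_primitiveRoots, hdeg, hφ] at hle
    nlinarith
  refine (linearIndepOn_primitiveRoots_of_squarefree hn K).sum_ne_sum_of_disjoint
    (hsub hζ') (hsub hξ) ?_ ?_ ((hsum hζ').trans (hsum hξ).symm)
  · rw [Finset.disjoint_left]
    intro y hy hy'
    simp only [Multiset.mem_toFinset, mem_roots (hne _), IsRoot, eval_sub, eval_C,
      sub_eq_zero] at hy hy'
    exact hξζ (hy'.symm.trans hy)
  · exact ⟨ζ, by simp [mem_roots (hne _)]⟩

lemma exists_comp_of_not_squarefree {n : ℕ} (hn : 3 ≤ n) (hsq : ¬ Squarefree n) (h4 : n ≠ 4) :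
    ∃ Q R : ℚ[X], 2 ≤ Q.natDegree ∧ 2 ≤ R.natDegree ∧ cyclotomic n ℚ = Q.comp R := by
  rw [Nat.squarefree_iff_prime_squarefree] at hsq
  push Not at hsq
  obtain ⟨p, hp, m, rfl⟩ := hsq
  have hp2 := hp.two_le
  have hm : 0 < m := Nat.pos_of_ne_zero (by rintro rfl; omega)
  have hpm : 2 < p * m := by
    by_contra! hle
    obtain rfl : m = 1 := by nlinarith
    obtain rfl : p = 2 := by omega
    omega
  refine ⟨cyclotomic (p * m) ℚ, X ^ p, ?_, by simpa using hp2, ?_⟩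
  · rw [natDegree_cyclotomic]
    have h1 := Nat.totient_even hpm
    have h2 : 0 < (p * m).totient := Nat.totient_pos.mpr (by omega)
    obtain ⟨k, hk⟩ := h1
    omega
  · rw [← expand_eq_comp_X_pow, cyclotomic_expand_eq_cyclotomic hp (dvd_mul_right p m)]
    congr 1
    ring

/-- Proposition 4.1: for `n ≥ 3`, the cyclotomic polynomial `Φ_n` is
indecomposable over `ℚ` if and only if `n` is squarefree or `n = 4`. -/
theorem cyclotomic_indecomposable_iff (n : ℕ) (hn : 3 ≤ n) :
    (¬ ∃ Q R : ℚ[X], 2 ≤ Q.natDegree ∧ 2 ≤ R.natDegree ∧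
        cyclotomic n ℚ = Q.comp R) ↔ (Squarefree n ∨ n = 4) := by
  constructor
  · intro h
    by_contra! hcon
    exact h (exists_comp_of_not_squarefree hn hcon.1 hcon.2)
  · rintro (hsq | rfl)
    · exact not_exists_comp_of_squarefree hsq
    · rintro ⟨Q, R, hQ, hR, h⟩
      have hdeg : Nat.totient 4 = Q.natDegree * R.natDegree := by
        rw [← natDegree_cyclotomic 4 ℚ, h, natDegree_comp]
      have h4 : Nat.totient 4 = 2 := by decide
      nlinarith
end

section
/- Let K be a commutative ring, let B, C ∈ K[X], and let j, k, h, n, s be natural numbers with k·h = n·j + s. If G = X^j · B(X)^k · C(X^h·B(X)^n) (that is, G = X^j * B^k * C.comp(X^h * B^n)), then X^s·G(X)^n = (X^k·C(X)^n) ∘ (X^h·B(X)^n) and X^s·G(X^n) = (X^k·C(X^n)) ∘ (X^h·B(X^n)). -/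
open Polynomial

/-- Lemma 4.5(b): if `k h = n j + s` and `G = X^j B^k C(X^h B^n)`, then
`X^s G(X)^n = (X^k C^n) ∘ (X^h B^n)` and
`X^s G(X^n) = (X^k C(X^n)) ∘ (X^h B(X^n))`. -/
theorem ritt_poly_decomposable_of_factorization {K : Type*} [CommRing K]
    (B C : K[X]) (j k h n s : ℕ) (hkh : k * h = n * j + s)
    (G : K[X]) (hG : G = X ^ j * B ^ k * C.comp (X ^ h * B ^ n)) :
    X ^ s * G ^ n = (X ^ k * C ^ n).comp (X ^ h * B ^ n) ∧
    X ^ s * G.comp (X ^ n) =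
      (X ^ k * C.comp (X ^ n)).comp (X ^ h * B.comp (X ^ n)) := by
  have hX : (X : K[X]) ^ (h * k) = X ^ (n * j) * X ^ s := by
    rw [← pow_add, mul_comm, hkh]
  subst hG
  constructor
  · simp only [mul_comp, pow_comp, X_comp, mul_pow, ← pow_mul, hX]
    ring
  · simp only [mul_comp, pow_comp, X_comp, comp_assoc, mul_pow, ← pow_mul, hX, mul_comm h n]
    ring
end

section
/- Let P, Q₁, Q₂ ∈ ℂ[X] with deg P = n ≥ 1, deg Q₁ ≥ 1 and deg Q₂ ≥ 1. If P ∘ Q₁ = P ∘ Q₂, then there exist ω, c ∈ ℂ with ω^n = 1 such that Q₂ = ω·Q₁ + c (i.e. Q₂ = C ω * Q₁ + C c as polynomials). -/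
open Polynomial

/-- If `F` and `G` have degree `q` and the same leading coefficient, then no cancellation occurs in
the top degree of the cofactor of `F - G` in `F ^ n - G ^ n`. -/
lemma coeff_geom_sum₂_of_natDegree_eq {R : Type*} [CommRing R] {F G : R[X]} {q : ℕ}
    (hF : F.natDegree = q) (hG : G.natDegree = q) (hFG : F.leadingCoeff = G.leadingCoeff) (n : ℕ) :
    (∑ i ∈ Finset.range n, F ^ i * G ^ (n - 1 - i)).coeff ((n - 1) * q) =
      n * F.leadingCoeff ^ (n - 1) := by
  rw [finsetSum_coeff, Finset.sum_congr rfl (g := fun _ => F.leadingCoeff ^ (n - 1))]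
  · simp
  intro i hi
  have hin : i + (n - 1 - i) = n - 1 := by
    have := Finset.mem_range.mp hi
    omega
  have hdeg : (n - 1) * q = i * q + (n - 1 - i) * q := by rw [← add_mul, hin]
  rw [hdeg, coeff_mul_add_eq_of_natDegree_le (natDegree_pow_le_of_le i hF.le)
    (natDegree_pow_le_of_le _ hG.le), coeff_pow_of_natDegree_le hF.le,
    coeff_pow_of_natDegree_le hG.le]
  have hF' : F.coeff q = F.leadingCoeff := by rw [leadingCoeff, hF]
  have hG' : G.coeff q = F.leadingCoeff := by rw [hFG, leadingCoeff, hG]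
  rw [hF', hG', ← pow_add, hin]

lemma natDegree_sub_add_le_natDegree_pow_sub_pow {R : Type*} [CommRing R] [IsDomain R] [CharZero R]
    {F G : R[X]} {q n : ℕ} (hF : F.natDegree = q) (hG : G.natDegree = q)
    (hFG : F.leadingCoeff = G.leadingCoeff) (hF0 : F ≠ 0) (hn : n ≠ 0) (hne : F - G ≠ 0) :
    (n - 1) * q + (F - G).natDegree ≤ (F ^ n - G ^ n).natDegree := by
  have hS : (∑ i ∈ Finset.range n, F ^ i * G ^ (n - 1 - i)).coeff ((n - 1) * q) ≠ 0 := by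
    rw [coeff_geom_sum₂_of_natDegree_eq hF hG hFG]
    exact mul_ne_zero (Nat.cast_ne_zero.mpr hn) (pow_ne_zero _ (leadingCoeff_ne_zero.mpr hF0))
  have hS0 : ∑ i ∈ Finset.range n, F ^ i * G ^ (n - 1 - i) ≠ 0 := by
    intro h0
    simp [h0] at hS
  rw [← geom_sum₂_mul, natDegree_mul hS0 hne]
  exact Nat.add_le_add_right (le_natDegree_of_ne_zero hS) _

lemma natDegree_pow_sub_pow_le_of_comp_eq {K : Type*} [Field K] {P F G : K[X]} {q : ℕ}
    (hP : P ≠ 0) (hF : F.natDegree = q) (hG : G.natDegree = q) (h : P.comp F = P.comp G) :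
    (F ^ P.natDegree - G ^ P.natDegree).natDegree ≤ (P.natDegree - 1) * q := by
  have hcomp : ∀ A : K[X],
      P.comp A = P.eraseLead.comp A + C P.leadingCoeff * A ^ P.natDegree := fun A => by
    have := congrArg (·.comp A) (eraseLead_add_C_mul_X_pow P)
    simpa only [add_comp, mul_comp, C_comp, X_pow_comp] using this.symm
  have key : C P.leadingCoeff * (F ^ P.natDegree - G ^ P.natDegree) =
      P.eraseLead.comp G - P.eraseLead.comp F := by
    rw [hcomp, hcomp G] at h
    linear_combination h
  rw [← natDegree_C_mul (leadingCoeff_ne_zero.mpr hP), key]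
  have hle : ∀ A : K[X], A.natDegree = q →
      (P.eraseLead.comp A).natDegree ≤ (P.natDegree - 1) * q := fun A hA =>
    natDegree_comp_le.trans (hA ▸ Nat.mul_le_mul_right _ (eraseLead_natDegree_le P))
  exact natDegree_sub_le_of_le (hle G hG) (hle F hF) |>.trans (max_self _).le

/-- Lemma 5.1(b): if `P ∘ Q₁ = P ∘ Q₂` with `deg P = n ≥ 1`, then
`Q₂ = ω Q₁ + c` for some `n`-th root of unity `ω` and constant `c`. -/
theorem comp_left_almost_cancel (P Q₁ Q₂ : ℂ[X])
    (hP : 1 ≤ P.natDegree) (hQ₁ : 1 ≤ Q₁.natDegree) (hQ₂ : 1 ≤ Q₂.natDegree)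
    (h : P.comp Q₁ = P.comp Q₂) :
    ∃ ω c : ℂ, ω ^ P.natDegree = 1 ∧ Q₂ = C ω * Q₁ + C c := by
  have hP0 : P ≠ 0 := ne_zero_of_natDegree_gt hP
  have hQ₁0 : Q₁ ≠ 0 := ne_zero_of_natDegree_gt hQ₁
  have hQ₂0 : Q₂ ≠ 0 := ne_zero_of_natDegree_gt hQ₂
  have hb₁ : Q₁.leadingCoeff ≠ 0 := leadingCoeff_ne_zero.mpr hQ₁0
  have hb₂ : Q₂.leadingCoeff ≠ 0 := leadingCoeff_ne_zero.mpr hQ₂0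
  have hdeg : Q₁.natDegree = Q₂.natDegree := by
    have := congrArg natDegree h
    rw [natDegree_comp, natDegree_comp] at this
    exact Nat.eq_of_mul_eq_mul_left hP this
  have hlead : Q₁.leadingCoeff ^ P.natDegree = Q₂.leadingCoeff ^ P.natDegree := by
    have := congrArg leadingCoeff h
    rw [leadingCoeff_comp (by omega), leadingCoeff_comp (by omega)] at this
    exact mul_left_cancel₀ (leadingCoeff_ne_zero.mpr hP0) this
  set ω : ℂ := Q₂.leadingCoeff / Q₁.leadingCoeff with hω
  have hω0 : ω ≠ 0 := div_ne_zero hb₂ hb₁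
  have hωn : ω ^ P.natDegree = 1 := by
    rw [hω, div_pow, hlead, div_self (pow_ne_zero _ hb₂)]
  have hconst : (Q₂ - C ω * Q₁).natDegree = 0 := by
    by_cases hne : Q₂ - C ω * Q₁ = 0
    · rw [hne, natDegree_zero]
    have hlower := natDegree_sub_add_le_natDegree_pow_sub_pow (n := P.natDegree) rfl
      ((natDegree_C_mul hω0).trans hdeg)
      (by rw [leadingCoeff_mul, leadingCoeff_C, hω, div_mul_cancel₀ _ hb₁]) hQ₂0 (by omega) hne
    rw [mul_pow, ← C_pow, hωn, C_1, one_mul] at hlower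
    have hupper := natDegree_pow_sub_pow_le_of_comp_eq hP0 rfl hdeg h.symm
    omega
  refine ⟨ω, (Q₂ - C ω * Q₁).coeff 0, hωn, ?_⟩
  rw [← eq_C_of_natDegree_eq_zero hconst]
  ring
end

section
/- Let P, Q, R, S ∈ ℂ[X] all have degree ≥ 2 and satisfy P ∘ Q = R ∘ S. Then the following are equivalent: (i) there exists α ∈ ℂ[X] with deg α = 1 and R = P ∘ α; (ii) there exists β ∈ ℂ[X] with deg β = 1 and S = β ∘ Q. -/
open Polynomial

namespace Polynomial

theorem comp_right_cancel_of_natDegree_pos {K : Type*} [Field K] {A B Q : K[X]}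
    (hQ : 0 < Q.natDegree) (h : A.comp Q = B.comp Q) : A = B := by
  have h0 : (A - B).comp Q = 0 := by rw [sub_comp, h, sub_self]
  rcases comp_eq_zero_iff.mp h0 with h1 | ⟨-, h1⟩
  · exact sub_eq_zero.mp h1
  · rw [h1, natDegree_C] at hQ
    exact absurd hQ (lt_irrefl 0)

/-- A polynomial of degree one has a two-sided compositional inverse of degree one. -/
theorem exists_comp_inverse_of_natDegree_eq_one {K : Type*} [Field K] {α : K[X]}
    (hα : α.natDegree = 1) :
    ∃ γ : K[X], γ.natDegree = 1 ∧ α.comp γ = X ∧ γ.comp α = X := by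
  obtain ⟨a, ha, b, rfl⟩ := natDegree_eq_one.mp hα
  have hC : C a * C a⁻¹ = (1 : K[X]) := by rw [← C_mul, mul_inv_cancel₀ ha, C_1]
  refine ⟨C a⁻¹ * X + C (-(a⁻¹ * b)), natDegree_linear (inv_ne_zero ha), ?_, ?_⟩
  · simp only [add_comp, mul_comp, C_comp, X_comp, C_neg, C_mul]
    linear_combination (X - C b) * hC
  · simp only [add_comp, mul_comp, C_comp, X_comp, C_neg, neg_comp, C_mul]
    linear_combination X * hC

theorem natDegree_geom_sum₂ {K : Type*} [Field K] [CharZero K] {A B : K[X]}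
    (hdeg : A.natDegree = B.natDegree) (hlead : A.leadingCoeff = B.leadingCoeff)
    (hA : A ≠ 0) {m : ℕ} (hm : 0 < m) :
    (∑ i ∈ Finset.range m, A ^ i * B ^ (m - 1 - i)).natDegree = (m - 1) * A.natDegree := by
  have hB : B ≠ 0 := by
    rwa [← leadingCoeff_ne_zero, ← hlead, leadingCoeff_ne_zero]
  have hterm : ∀ i ∈ Finset.range m,
      (A ^ i * B ^ (m - 1 - i)).natDegree = (m - 1) * A.natDegree := by
    intro i hi
    have hi' : i + (m - 1 - i) = m - 1 := by
      have := Finset.mem_range.mp hi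
      omega
    rw [natDegree_mul (pow_ne_zero _ hA) (pow_ne_zero _ hB), natDegree_pow, natDegree_pow,
      ← hdeg, ← add_mul, hi']
  refine natDegree_eq_of_le_of_coeff_ne_zero
    (natDegree_sum_le_of_forall_le _ _ fun i hi => (hterm i hi).le) ?_
  have hcoeff : ∀ i ∈ Finset.range m,
      (A ^ i * B ^ (m - 1 - i)).coeff ((m - 1) * A.natDegree) = A.leadingCoeff ^ (m - 1) := by
    intro i hi
    have hi' : i + (m - 1 - i) = m - 1 := by
      have := Finset.mem_range.mp hi
      omega
    rw [← hterm i hi, coeff_natDegree, leadingCoeff_mul, leadingCoeff_pow, leadingCoeff_pow,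
      ← hlead, ← pow_add, hi']
  rw [finsetSum_coeff, Finset.sum_congr rfl hcoeff, Finset.sum_const, Finset.card_range,
    nsmul_eq_mul]
  exact mul_ne_zero (Nat.cast_ne_zero.mpr hm.ne') (pow_ne_zero _ (leadingCoeff_ne_zero.mpr hA))

/-- In characteristic zero, two polynomials with the same composite under a nonconstant `P`
differ by an affine map on the left. -/
theorem exists_eq_C_mul_add_C_of_comp_eq {K : Type*} [Field K] [CharZero K] {P Q T : K[X]}
    (hP : 0 < P.natDegree) (hQ : 0 < Q.natDegree) (h : P.comp Q = P.comp T) :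
    ∃ a : K, a ≠ 0 ∧ ∃ b : K, T = C a * Q + C b := by
  have hdeg : Q.natDegree = T.natDegree := by
    have := congrArg natDegree h
    rw [natDegree_comp, natDegree_comp] at this
    exact Nat.eq_of_mul_eq_mul_left hP this
  have hQ0 : Q.leadingCoeff ≠ 0 := leadingCoeff_ne_zero.mpr (ne_zero_of_natDegree_gt hQ)
  have hT0 : T.leadingCoeff ≠ 0 :=
    leadingCoeff_ne_zero.mpr (ne_zero_of_natDegree_gt (hdeg ▸ hQ))
  have hP0 : P.leadingCoeff ≠ 0 := leadingCoeff_ne_zero.mpr (ne_zero_of_natDegree_gt hP)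
  set m := P.natDegree
  have hlead : Q.leadingCoeff ^ m = T.leadingCoeff ^ m := by
    have := congrArg leadingCoeff h
    rw [leadingCoeff_comp hQ.ne', leadingCoeff_comp (hdeg ▸ hQ.ne')] at this
    exact mul_left_cancel₀ hP0 this
  set a := T.leadingCoeff / Q.leadingCoeff with ha
  have ha0 : a ≠ 0 := div_ne_zero hT0 hQ0
  have ham : a ^ m = 1 := by rw [ha, div_pow, hlead, div_self (pow_ne_zero _ hT0)]
  have hUdeg : T.natDegree = (C a * Q).natDegree := by rw [natDegree_C_mul ha0, hdeg]
  have hUlead : T.leadingCoeff = (C a * Q).leadingCoeff := by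
    rw [leadingCoeff_mul, leadingCoeff_C, ha, div_mul_cancel₀ _ hQ0]
  have hgeom := (Commute.all T (C a * Q)).geom_sum₂_mul m
  set G := ∑ i ∈ Finset.range m, T ^ i * (C a * Q) ^ (m - 1 - i) with hG
  have hGdeg : G.natDegree = (m - 1) * T.natDegree :=
    natDegree_geom_sum₂ hUdeg hUlead (leadingCoeff_ne_zero.mp hT0) hP
  have hUm : (C a * Q) ^ m = Q ^ m := by rw [mul_pow, ← C_pow, ham, C_1, one_mul]
  have hexp : ∀ A : K[X], P.comp A = P.eraseLead.comp A + C P.leadingCoeff * A ^ m := by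
    intro A
    have hA := congrArg (fun B : K[X] => B.comp A) (eraseLead_add_C_mul_X_pow P)
    simp only [add_comp, mul_comp, C_comp, X_pow_comp] at hA
    exact hA.symm
  have hmain : C P.leadingCoeff * (G * (T - C a * Q)) =
      P.eraseLead.comp Q - P.eraseLead.comp T := by
    rw [hgeom, hUm]
    linear_combination hexp Q - hexp T - h
  have hle : (C P.leadingCoeff * (G * (T - C a * Q))).natDegree ≤ (m - 1) * T.natDegree := by
    have he := eraseLead_natDegree_le P
    rw [hmain]
    refine (natDegree_sub_le_of_le ?_ ?_).trans (max_self _).le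
    · rw [natDegree_comp, hdeg]
      gcongr
    · rw [natDegree_comp]
      gcongr
  have hD : (T - C a * Q).natDegree = 0 := by
    by_contra hne
    have hD0 : T - C a * Q ≠ 0 := fun h0 => hne (by rw [h0, natDegree_zero])
    have hG0 : G ≠ 0 := by
      intro h0
      have hm1 : m ≠ 1 := by
        intro h1
        rw [hG, h1] at h0
        simp at h0
      have : 0 < (m - 1) * T.natDegree := Nat.mul_pos (by omega) (hdeg ▸ hQ)
      rw [← hGdeg, h0, natDegree_zero] at this
      exact lt_irrefl 0 this
    rw [natDegree_C_mul hP0, natDegree_mul hG0 hD0, hGdeg] at hle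
    omega
  obtain ⟨b, hb⟩ := natDegree_eq_zero.mp hD
  exact ⟨a, ha0, b, by rw [hb]; ring⟩

end Polynomial

/-- Corollary 5.2: for `P ∘ Q = R ∘ S` with all degrees ≥ 2, `R` differs from
`P` by an affine map on the right iff `S` differs from `Q` by an affine map
on the left. -/
theorem comp_eq_affine_iff (P Q R S : ℂ[X])
    (hP : 2 ≤ P.natDegree) (hQ : 2 ≤ Q.natDegree)
    (hR : 2 ≤ R.natDegree) (hS : 2 ≤ S.natDegree)
    (h : P.comp Q = R.comp S) :
    (∃ α : ℂ[X], α.natDegree = 1 ∧ R = P.comp α) ↔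
    (∃ β : ℂ[X], β.natDegree = 1 ∧ S = β.comp Q) := by
  constructor
  · rintro ⟨α, hα, rfl⟩
    obtain ⟨γ, hγ, -, hγα⟩ := exists_comp_inverse_of_natDegree_eq_one hα
    rw [comp_assoc] at h
    obtain ⟨a, ha, b, hT⟩ := exists_eq_C_mul_add_C_of_comp_eq (by omega) (by omega) h
    refine ⟨γ.comp (C a * X + C b), ?_, ?_⟩
    · rw [natDegree_comp, hγ, natDegree_linear ha]
    · have hlin : (C a * X + C b).comp Q = α.comp S := by rw [hT]; simp
      rw [comp_assoc, hlin, ← comp_assoc, hγα, X_comp]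
  · rintro ⟨β, hβ, rfl⟩
    obtain ⟨γ, hγ, hβγ, -⟩ := exists_comp_inverse_of_natDegree_eq_one hβ
    rw [← comp_assoc] at h
    refine ⟨γ, hγ, ?_⟩
    rw [comp_right_cancel_of_natDegree_pos (by omega) h, comp_assoc, hβγ, comp_X]
end
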